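/- Let φ be a Drinfeld module of rank r over 𝕂 given by φ_t = θ + A_1 τ + ⋯ + A_r τ^r. Let π_1, …, π_r be an A-basis of the period lattice Λ_φ, and for 1 ≤ j ≤ r set f_j := f_φ(π_j; t). Then the matrix Υ := (f_j^{(i−1)})_{1≤i,j≤r} lies in GL_r(𝕋) and satisfies Υ^{(1)} = Θ Υ; that is, Υ is a rigid analytic trivialization for φ with respect to Θ. -/

import Mathlib

open Filter

set_option maxHeartbeats 1000000
set_option synthInstance.maxHeartbeats 400000

noncomputable section

namespace DrinfeldRAT

variable (𝕂 : Type) [NontriviallyNormedField 𝕂]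

/-- `deg x := log_q ‖x‖`. -/
def degK (q : ℕ) (x : 𝕂) : ℝ := Real.logb q ‖x‖

/-- The action of `φ_t` on `𝕂`: `φ_t(x) = θ x + A_1 x^q + ⋯ + A_r x^{q^r}`. -/
def phiT (q r : ℕ) (θ : 𝕂) (A : ℕ → 𝕂) (x : 𝕂) : 𝕂 :=
  θ * x + ∑ i ∈ Finset.Icc 1 r, A i * x ^ q ^ i

/-- Membership in `N(φ) = {1 ≤ i ≤ r : A_i ≠ 0}`. -/
def inNphi (r : ℕ) (A : ℕ → 𝕂) (i : ℕ) : Prop := 1 ≤ i ∧ i ≤ r ∧ A i ≠ 0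

/-- `μ_n = (deg A_n − q^n)/(q^n − 1)`. -/
def muPhi (q : ℕ) (A : ℕ → 𝕂) (n : ℕ) : ℝ :=
  (degK 𝕂 q (A n) - (q : ℝ) ^ n) / ((q : ℝ) ^ n - 1)

/-- `m` is the smallest index in `N(φ)` at which `μ` is maximal on `N(φ)`. -/
def IsMuIndex (q r : ℕ) (A : ℕ → 𝕂) (m : ℕ) : Prop :=
  inNphi 𝕂 r A m ∧ (∀ i, inNphi 𝕂 r A i → muPhi 𝕂 q A i ≤ muPhi 𝕂 q A m) ∧
    ∀ m', inNphi 𝕂 r A m' → (∀ i, inNphi 𝕂 r A i → muPhi 𝕂 q A i ≤ muPhi 𝕂 q A m') → m ≤ m'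

/-- `R_φ = q^{−μ_m}` (a real power). -/
def Rphi (q : ℕ) (A : ℕ → 𝕂) (m : ℕ) : ℝ := (q : ℝ) ^ (-(muPhi 𝕂 q A m))

/-- The coefficient of `x^{q^n}` in `φ_t(x)`, with `A₀ = θ`. -/
def Acoef (θ : 𝕂) (A : ℕ → 𝕂) (n : ℕ) : 𝕂 := if n = 0 then θ else A n

/-- Data of the Newton polygon of `φ_t(x)`: vertices `(q^{d_j}, −deg A_{d_j})`,
`0 = d_0 < d_1 < ⋯ < d_s = r`, with strictly increasing edge slopes `λ_1 < ⋯ < λ_s`,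
such that every point `(q^n, −deg A_n)` (for `A_n ≠ 0`, including `n = 0`) lies on or
above each edge line (lower convex hull). -/
structure NewtonData (q r : ℕ) (θ : 𝕂) (A : ℕ → 𝕂) where
  s : ℕ
  d : ℕ → ℕ
  lam : ℕ → ℝ
  s_pos : 0 < s
  d_zero : d 0 = 0
  d_last : d s = r
  d_mono : ∀ j < s, d j < d (j + 1)
  vertex_ne : ∀ j, 1 ≤ j → j ≤ s → A (d j) ≠ 0
  slope_eq : ∀ j, 1 ≤ j → j ≤ s →
    lam j = (degK 𝕂 q (Acoef 𝕂 θ A (d (j - 1))) - degK 𝕂 q (Acoef 𝕂 θ A (d j))) /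
      ((q : ℝ) ^ d j - (q : ℝ) ^ d (j - 1))
  lam_mono : ∀ j, 1 ≤ j → j + 1 ≤ s → lam j < lam (j + 1)
  hull : ∀ n ≤ r, Acoef 𝕂 θ A n ≠ 0 → ∀ j, 1 ≤ j → j ≤ s →
    lam j * ((q : ℝ) ^ n - (q : ℝ) ^ d j) + (-(degK 𝕂 q (Acoef 𝕂 θ A (d j)))) ≤
      -(degK 𝕂 q (Acoef 𝕂 θ A n))

/-- `x 0, …, x (r−1)` is an `𝔽_q`-basis of `φ[t]` (`𝔽_q ⊆ 𝕂` is the set of `c` with `c^q = c`). -/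
def IsFqBasis (q r : ℕ) (θ : 𝕂) (A : ℕ → 𝕂) (x : Fin r → 𝕂) : Prop :=
  (∀ j, phiT 𝕂 q r θ A (x j) = 0) ∧
    ∀ y, phiT 𝕂 q r θ A y = 0 →
      ∃! c : Fin r → 𝕂, (∀ j, c j ^ q = c j) ∧ y = ∑ j, c j * x j

/-- Strictness of a basis of `φ[t]` with respect to Newton polygon data:
`deg x_j = λ_k` for `d_{k−1} < j ≤ d_k` (here `x` is indexed from `0`). -/
def IsStrict (q r : ℕ) (θ : 𝕂) (A : ℕ → 𝕂) (ND : NewtonData 𝕂 q r θ A)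
    (x : Fin r → 𝕂) : Prop :=
  ∀ k, 1 ≤ k → k ≤ ND.s → ∀ j : Fin r, ND.d (k - 1) ≤ (j : ℕ) → (j : ℕ) < ND.d k →
    degK 𝕂 q (x j) = ND.lam k

/-- The conditions of Proposition `good-xi` on `ξ_1, …, ξ_r ∈ φ[t^N]`:
`|ξ_j| < R_φ`, `φ_{t^{N−1}}(ξ_j) = x_j`, and
`deg φ_{t^{N−1}}(ξ_j) > ⋯ > deg φ_t(ξ_j) > deg ξ_j`. -/
def GoodXi (q r N : ℕ) (θ : 𝕂) (A : ℕ → 𝕂) (m : ℕ) (x ξ : Fin r → 𝕂) : Prop :=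
  ∀ j, (phiT 𝕂 q r θ A)^[N] (ξ j) = 0 ∧
    ‖ξ j‖ < Rphi 𝕂 q A m ∧
    (phiT 𝕂 q r θ A)^[N - 1] (ξ j) = x j ∧
    ∀ i, i + 1 ≤ N - 1 →
      degK 𝕂 q ((phiT 𝕂 q r θ A)^[i] (ξ j)) < degK 𝕂 q ((phiT 𝕂 q r θ A)^[i + 1] (ξ j))

/-- Gauss norm of a power series. -/
def gnorm (f : PowerSeries 𝕂) : ℝ := ⨆ i : ℕ, ‖PowerSeries.coeff i f‖

/-- Membership in the Tate algebra `𝕋`: coefficients tend to `0`. -/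
def IsTate (f : PowerSeries 𝕂) : Prop :=
  Tendsto (fun i => ‖PowerSeries.coeff i f‖) atTop (nhds 0)

/-- `n`-th Frobenius twist of a power series: coefficients raised to the `q^n` power. -/
def twist (q n : ℕ) (f : PowerSeries 𝕂) : PowerSeries 𝕂 :=
  PowerSeries.mk fun i => PowerSeries.coeff i f ^ q ^ n

/-- Entrywise Frobenius twist of a matrix of power series. -/
def twistM {r : ℕ} (q n : ℕ) (M : Matrix (Fin r) (Fin r) (PowerSeries 𝕂)) :
    Matrix (Fin r) (Fin r) (PowerSeries 𝕂) :=
  Matrix.of fun i j => twist 𝕂 q n (M i j)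

/-- Gauss norm of a matrix: maximum of the Gauss norms of the entries. -/
def mnorm {r : ℕ} (M : Matrix (Fin r) (Fin r) (PowerSeries 𝕂)) : ℝ :=
  ⨆ p : Fin r × Fin r, gnorm 𝕂 (M p.1 p.2)

/-- Membership in `GL_r(𝕋)`: all entries in `𝕋` and two-sided inverse with entries in `𝕋`. -/
def MemGLT {r : ℕ} (M : Matrix (Fin r) (Fin r) (PowerSeries 𝕂)) : Prop :=
  (∀ i j, IsTate 𝕂 (M i j)) ∧
    ∃ C : Matrix (Fin r) (Fin r) (PowerSeries 𝕂),
      (∀ i j, IsTate 𝕂 (C i j)) ∧ M * C = 1 ∧ C * M = 1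

/-- The matrix `Θ`, with entries viewed in `𝕂[[t]]`. -/
def ThetaPS (r : ℕ) (θ : 𝕂) (A : ℕ → 𝕂) : Matrix (Fin r) (Fin r) (PowerSeries 𝕂) :=
  Matrix.of fun i j =>
    if (i : ℕ) + 1 < r then (if (j : ℕ) = (i : ℕ) + 1 then 1 else 0)
    else if (j : ℕ) = 0 then (PowerSeries.X - PowerSeries.C θ) * PowerSeries.C (A r)⁻¹
    else -(PowerSeries.C (A (j : ℕ)) * PowerSeries.C (A r)⁻¹)

/-- `h = φ_{t^{N−1}}(ξ) + φ_{t^{N−2}}(ξ) t + ⋯ + ξ t^{N−1}` viewed in `𝕂[[t]]`. -/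
def hPS (q r N : ℕ) (θ : 𝕂) (A : ℕ → 𝕂) (ξ : 𝕂) : PowerSeries 𝕂 :=
  ∑ mm ∈ Finset.range N, PowerSeries.C ((phiT 𝕂 q r θ A)^[N - 1 - mm] ξ) * PowerSeries.X ^ mm

/-- The matrix `B = (h_j^{(i−1)})`. -/
def BPS (q r N : ℕ) (θ : 𝕂) (A : ℕ → 𝕂) (ξ : Fin r → 𝕂) :
    Matrix (Fin r) (Fin r) (PowerSeries 𝕂) :=
  Matrix.of fun i j => twist 𝕂 q (i : ℕ) (hPS 𝕂 q r N θ A (ξ j))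

/-- Partial products `F F^{(1)} ⋯ F^{(n)}` (successive factors multiplied on the right). -/
def prodTwists {r : ℕ} (q : ℕ) (F : Matrix (Fin r) (Fin r) (PowerSeries 𝕂)) (n : ℕ) :
    Matrix (Fin r) (Fin r) (PowerSeries 𝕂) :=
  ((List.range (n + 1)).map fun k => twistM 𝕂 q k F).prod

/-- Convergence of a sequence of matrices with respect to the Gauss norm. -/
def MTendsto {r : ℕ} (g : ℕ → Matrix (Fin r) (Fin r) (PowerSeries 𝕂))
    (P : Matrix (Fin r) (Fin r) (PowerSeries 𝕂)) : Prop :=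
  Tendsto (fun n => mnorm 𝕂 (g n - P)) atTop (nhds 0)

/-- Shadowed partitions: `(S_1, …, S_r) ∈ P_r(n)` iff `S_i ⊆ {0, …, n−1}` and the translates
`S_i + j`, `0 ≤ j ≤ i−1`, partition `{0, …, n−1}` (here `S i` is the paper's `S_{i+1}`). -/
def IsShadow (r n : ℕ) (S : Fin r → Finset ℕ) : Prop :=
  (∀ i, S i ⊆ Finset.range n) ∧
    ∀ x ∈ Finset.range n, ∃! p : Fin r × ℕ, p.2 ≤ (p.1 : ℕ) ∧ ∃ y ∈ S p.1, x = y + p.2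

open Classical in
/-- The (finite) set `P_r(n)` of shadowed partitions. -/
def shadowFinset (r n : ℕ) : Finset (Fin r → Finset ℕ) :=
  (Fintype.piFinset fun _ : Fin r => (Finset.range n).powerset).filter (IsShadow r n)

/-- `𝓑_n(t)` as an element of `𝕂[[t]]` (expanded on the unit disk). -/
def BnPS (q r : ℕ) (θ : 𝕂) (A : ℕ → 𝕂) (n : ℕ) : PowerSeries 𝕂 :=
  ∑ S ∈ shadowFinset r n, ∏ i : Fin r, ∏ j ∈ S i,
    PowerSeries.C (A ((i : ℕ) + 1) ^ q ^ j) *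
      (PowerSeries.X - PowerSeries.C (θ ^ q ^ ((i : ℕ) + 1 + j)))⁻¹

/-- Partial sums of `ℒ_φ(ξ;t) = Σ_n 𝓑_n(t) ξ^{q^n}`. -/
def LPartial (q r : ℕ) (θ : 𝕂) (A : ℕ → 𝕂) (ξ : 𝕂) (n : ℕ) : PowerSeries 𝕂 :=
  ∑ k ∈ Finset.range (n + 1), BnPS 𝕂 q r θ A k * PowerSeries.C (ξ ^ q ^ k)

/-- The exponential function `exp_φ(z) = Σ α_n z^{q^n}`. -/
def expF (q : ℕ) (α : ℕ → 𝕂) (z : 𝕂) : 𝕂 := ∑' n : ℕ, α n * z ^ q ^ n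

/-- Anderson generating function `f_φ(u;t) = Σ_m exp_φ(u/θ^{m+1}) t^m`. -/
def AGF (q : ℕ) (α : ℕ → 𝕂) (θ u : 𝕂) : PowerSeries 𝕂 :=
  PowerSeries.mk fun mm => expF 𝕂 q α (u / θ ^ (mm + 1))

/-- The subring `A = 𝔽_q[θ]` of `𝕂`. -/
def Asubring (q : ℕ) (θ : 𝕂) : Subring 𝕂 :=
  Subring.closure ({θ} ∪ {c : 𝕂 | c ^ q = c})

/-- `π_1, …, π_r` is an `A`-basis of the period lattice `Λ_φ = ker exp_φ`. -/
def IsPeriodBasis (q r : ℕ) (α : ℕ → 𝕂) (θ : 𝕂) (π : Fin r → 𝕂) : Prop :=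
  (∀ j, expF 𝕂 q α (π j) = 0) ∧
    ∀ z, expF 𝕂 q α z = 0 →
      ∃! a : Fin r → 𝕂, (∀ j, a j ∈ Asubring 𝕂 q θ) ∧ z = ∑ j, a j * π j

/-- Frobenius twist on `𝕂(t)`, induced by a Frobenius endomorphism of `𝕂`. -/
def twistRF (frobq : 𝕂 →+* 𝕂) : RatFunc 𝕂 →+* RatFunc 𝕂 :=
  RatFunc.mapRingHom (Polynomial.mapRingHom frobq) (by
    intro pp hpp
    simp only [Submonoid.mem_comap, Polynomial.coe_mapRingHom]
    rw [mem_nonZeroDivisors_iff_ne_zero] at hpp ⊢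
    exact (Polynomial.map_ne_zero_iff frobq.injective).mpr hpp)

/-- Entrywise `n`-fold Frobenius twist of a matrix over `𝕂(t)`. -/
def twistMRF {r : ℕ} (frobq : 𝕂 →+* 𝕂) (n : ℕ)
    (M : Matrix (Fin r) (Fin r) (RatFunc 𝕂)) : Matrix (Fin r) (Fin r) (RatFunc 𝕂) :=
  Matrix.of fun i j => (fun g => twistRF 𝕂 frobq g)^[n] (M i j)

/-- The matrix `Θ`, with entries viewed in `𝕂(t)`. -/
def ThetaRF (r : ℕ) (θ : 𝕂) (A : ℕ → 𝕂) : Matrix (Fin r) (Fin r) (RatFunc 𝕂) :=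
  Matrix.of fun i j =>
    if (i : ℕ) + 1 < r then (if (j : ℕ) = (i : ℕ) + 1 then 1 else 0)
    else if (j : ℕ) = 0 then (RatFunc.X - RatFunc.C θ) / RatFunc.C (A r)
    else -(RatFunc.C (A (j : ℕ)) / RatFunc.C (A r))

/-- `h` as an element of `𝕂(t)`. -/
def hRF (q r N : ℕ) (θ : 𝕂) (A : ℕ → 𝕂) (ξ : 𝕂) : RatFunc 𝕂 :=
  ∑ mm ∈ Finset.range N, RatFunc.C ((phiT 𝕂 q r θ A)^[N - 1 - mm] ξ) * RatFunc.X ^ mm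

/-- The matrix `B = (h_j^{(i−1)})` over `𝕂(t)`. -/
def BRF (q r N : ℕ) (frobq : 𝕂 →+* 𝕂) (θ : 𝕂) (A : ℕ → 𝕂) (ξ : Fin r → 𝕂) :
    Matrix (Fin r) (Fin r) (RatFunc 𝕂) :=
  Matrix.of fun i j => (fun g => twistRF 𝕂 frobq g)^[(i : ℕ)] (hRF 𝕂 q r N θ A (ξ j))

/-- The matrix `W` with first row `(ξ_1, …, ξ_r)` and all other entries `0`. -/
def WRF (r : ℕ) (ξ : Fin r → 𝕂) : Matrix (Fin r) (Fin r) (RatFunc 𝕂) :=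
  Matrix.of fun i j => if (i : ℕ) = 0 then RatFunc.C (ξ j) else 0

/-- `R_0 = I/(t−θ)` and `R_m = Θ^{−1}(Θ^{−1})^{(1)} ⋯ (Θ^{−1})^{(m−1)}/(t−θ^{q^m})`. -/
def RmRF (r : ℕ) (frobq : 𝕂 →+* 𝕂) (q : ℕ) (θ : 𝕂) (A : ℕ → 𝕂) (mm : ℕ) :
    Matrix (Fin r) (Fin r) (RatFunc 𝕂) :=
  (RatFunc.X - RatFunc.C (θ ^ q ^ mm))⁻¹ •
    ((List.range mm).map fun k => twistMRF 𝕂 frobq k (ThetaRF 𝕂 r θ A)⁻¹).prod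

/-- `𝓑_n(t)` as an element of `𝕂(t)`. -/
def BnRF (q r : ℕ) (θ : 𝕂) (A : ℕ → 𝕂) (n : ℕ) : RatFunc 𝕂 :=
  ∑ S ∈ shadowFinset r n, ∏ i : Fin r, ∏ j ∈ S i,
    RatFunc.C (A ((i : ℕ) + 1) ^ q ^ j) / (RatFunc.X - RatFunc.C (θ ^ q ^ ((i : ℕ) + 1 + j)))

/-- `𝓑_n(t)` for integer `n`, with `𝓑_n = 0` for `n < 0`. -/
def BnRFZ (q r : ℕ) (θ : 𝕂) (A : ℕ → 𝕂) (n : ℤ) : RatFunc 𝕂 :=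
  if n < 0 then 0 else BnRF 𝕂 q r θ A n.toNat

/-- `F = B^{−1} Θ^{−1} B^{(1)}` over `𝕂(t)`. -/
def FRF (q r N : ℕ) (frobq : 𝕂 →+* 𝕂) (θ : 𝕂) (A : ℕ → 𝕂) (ξ : Fin r → 𝕂) :
    Matrix (Fin r) (Fin r) (RatFunc 𝕂) :=
  (BRF 𝕂 q r N frobq θ A ξ)⁻¹ * (ThetaRF 𝕂 r θ A)⁻¹ *
    twistMRF 𝕂 frobq 1 (BRF 𝕂 q r N frobq θ A ξ)

/-- `Π_n = B F F^{(1)} ⋯ F^{(n)}` over `𝕂(t)`. -/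
def PiNRF (q r N : ℕ) (frobq : 𝕂 →+* 𝕂) (θ : 𝕂) (A : ℕ → 𝕂) (ξ : Fin r → 𝕂) (n : ℕ) :
    Matrix (Fin r) (Fin r) (RatFunc 𝕂) :=
  BRF 𝕂 q r N frobq θ A ξ *
    ((List.range (n + 1)).map fun k => twistMRF 𝕂 frobq k (FRF 𝕂 q r N frobq θ A ξ)).prod


section RAT

set_option linter.unusedSectionVars false

variable {𝕂 : Type} [NontriviallyNormedField 𝕂]

/-- The Tate algebra as a subring of the power series ring. -/
def TS (𝕂 : Type) [NontriviallyNormedField 𝕂] [IsUltrametricDist 𝕂] :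
    Subring (PowerSeries 𝕂) :=
  PowerSeries.IsRestricted.subring (1 : ℝ)

variable [IsUltrametricDist 𝕂]

theorem mem_TS {f : PowerSeries 𝕂} : f ∈ TS 𝕂 ↔ IsTate 𝕂 f := by
  have h : f ∈ TS 𝕂 ↔ PowerSeries.IsRestricted 1 f := Iff.rfl
  rw [h, PowerSeries.isRestricted_iff']
  simp [IsTate]

theorem mem_TS' {f : PowerSeries 𝕂} :
    f ∈ TS 𝕂 ↔ Tendsto (fun i => PowerSeries.coeff i f) atTop (nhds 0) := by
  rw [mem_TS, IsTate]
  exact tendsto_zero_iff_norm_tendsto_zero.symm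

theorem C_mem_TS (c : 𝕂) : PowerSeries.C c ∈ TS 𝕂 :=
  PowerSeries.isRestricted_C 1 c

theorem X_mem_TS : (PowerSeries.X : PowerSeries 𝕂) ∈ TS 𝕂 :=
  PowerSeries.isRestricted_monomial 1 1 1

theorem poly_mem_TS (a : Polynomial 𝕂) : (a : PowerSeries 𝕂) ∈ TS 𝕂 := by
  rw [mem_TS']
  refine tendsto_const_nhds.congr' ?_
  filter_upwards [eventually_gt_atTop a.natDegree] with i hi
  rw [Polynomial.coeff_coe, Polynomial.coeff_eq_zero_of_natDegree_lt hi]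

theorem map_mem_TS (σ : 𝕂 →+* 𝕂) (hσ : Continuous σ) {f : PowerSeries 𝕂} (hf : f ∈ TS 𝕂) :
    PowerSeries.map σ f ∈ TS 𝕂 := by
  rw [mem_TS'] at *
  simp only [PowerSeries.coeff_map]
  have := (hσ.tendsto 0).comp hf
  rw [map_zero] at this
  exact this

variable [CompleteSpace 𝕂]

theorem summable_of_tendsto_zero {g : ℕ → 𝕂} (h : Tendsto g atTop (nhds 0)) : Summable g := by
  apply NonarchimedeanAddGroup.summable_of_tendsto_cofinite_zero
  rwa [Nat.cofinite_eq_atTop]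

theorem tendsto_mul_pow {g : ℕ → 𝕂} (h : Tendsto g atTop (nhds 0)) {z : 𝕂} (hz : ‖z‖ ≤ 1) :
    Tendsto (fun i => g i * z ^ i) atTop (nhds 0) := by
  rw [tendsto_zero_iff_norm_tendsto_zero] at *
  refine squeeze_zero (fun _ => norm_nonneg _) (fun i => ?_) h
  rw [norm_mul, norm_pow]
  exact mul_le_of_le_one_right (norm_nonneg _) (pow_le_one₀ (norm_nonneg _) hz)

theorem summable_ev {f : PowerSeries 𝕂} (hf : f ∈ TS 𝕂) {z : 𝕂} (hz : ‖z‖ ≤ 1) :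
    Summable (fun i => PowerSeries.coeff i f * z ^ i) :=
  summable_of_tendsto_zero (tendsto_mul_pow (mem_TS'.1 hf) hz)

/-- Evaluation on the closed unit disc. -/
def ev (z : 𝕂) (f : PowerSeries 𝕂) : 𝕂 := ∑' i, PowerSeries.coeff i f * z ^ i

theorem ev_add {z : 𝕂} (hz : ‖z‖ ≤ 1) {f g : PowerSeries 𝕂} (hf : f ∈ TS 𝕂) (hg : g ∈ TS 𝕂) :
    ev z (f + g) = ev z f + ev z g := by
  unfold ev
  rw [← (summable_ev hf hz).tsum_add (summable_ev hg hz)]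
  simp [add_mul]

theorem ev_mul {z : 𝕂} (hz : ‖z‖ ≤ 1) {f g : PowerSeries 𝕂} (hf : f ∈ TS 𝕂) (hg : g ∈ TS 𝕂) :
    ev z (f * g) = ev z f * ev z g := by
  have : NonarchimedeanRing 𝕂 :=
    { is_nonarchimedean := NonarchimedeanAddGroup.is_nonarchimedean }
  unfold ev
  rw [(summable_ev hf hz).tsum_mul_tsum_eq_tsum_sum_antidiagonal (summable_ev hg hz)
    ((summable_ev hf hz).mul_of_nonarchimedean (summable_ev hg hz))]
  congr 1
  ext n
  rw [PowerSeries.coeff_mul, Finset.sum_mul]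
  refine Finset.sum_congr rfl fun x hx => ?_
  rw [← Finset.HasAntidiagonal.mem_antidiagonal.1 hx, pow_add]
  ring

theorem ev_poly (z : 𝕂) (a : Polynomial 𝕂) : ev z (a : PowerSeries 𝕂) = a.eval z := by
  unfold ev
  rw [Polynomial.eval_eq_sum_range]
  rw [tsum_eq_sum (s := Finset.range (a.natDegree + 1))]
  · simp
  · intro b hb
    rw [Polynomial.coeff_coe, Polynomial.coeff_eq_zero_of_natDegree_lt, zero_mul]
    simpa using hb

theorem ev_C (z c : 𝕂) : ev z (PowerSeries.C c) = c := by
  have := ev_poly z (Polynomial.C c)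
  simpa using this

theorem ev_X (z : 𝕂) : ev z (PowerSeries.X) = z := by
  have := ev_poly z (Polynomial.X)
  simpa using this

/-- Evaluation as a ring homomorphism. -/
def evHom (z : 𝕂) (hz : ‖z‖ ≤ 1) : TS 𝕂 →+* 𝕂 where
  toFun f := ev z f.1
  map_one' := by simpa using ev_C z (1 : 𝕂)
  map_zero' := by simpa using ev_C z (0 : 𝕂)
  map_add' f g := ev_add hz f.2 g.2
  map_mul' f g := ev_mul hz f.2 g.2

theorem ev_sum {ι : Type*} (s : Finset ι) {z : 𝕂} (hz : ‖z‖ ≤ 1) {f : ι → PowerSeries 𝕂}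
    (hf : ∀ i ∈ s, f i ∈ TS 𝕂) : ev z (∑ i ∈ s, f i) = ∑ i ∈ s, ev z (f i) := by
  classical
  induction s using Finset.induction_on with
  | empty => simpa using ev_C z (0 : 𝕂)
  | insert a s ha ih =>
    rw [Finset.sum_insert ha, Finset.sum_insert ha, ev_add hz (hf a (by simp))
      (Subring.sum_mem _ fun i hi => hf i (by simp [hi])), ih fun i hi => hf i (by simp [hi])]

theorem ev_map (σ : 𝕂 →+* 𝕂) (hσ : Continuous σ) {z : 𝕂} (hz : ‖z‖ ≤ 1) {f : PowerSeries 𝕂}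
    (hf : f ∈ TS 𝕂) : ev (σ z) (PowerSeries.map σ f) = σ (ev z f) := by
  unfold ev
  rw [(summable_ev hf hz).map_tsum σ hσ]
  simp

theorem norm_ev_le {z : 𝕂} (hz : ‖z‖ ≤ 1) {f : PowerSeries 𝕂} {c : ℝ} (hc : 0 ≤ c)
    (h : ∀ i, ‖PowerSeries.coeff i f‖ ≤ c) : ‖ev z f‖ ≤ c := by
  refine IsUltrametricDist.norm_tsum_le_of_forall_le_of_nonneg hc fun i => ?_
  rw [norm_mul, norm_pow]
  exact (mul_le_of_le_one_right (norm_nonneg _) (pow_le_one₀ (norm_nonneg _) hz)).trans (h i)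

/-- Division by `X - z` on the Tate algebra. -/
theorem exists_div {z : 𝕂} (hz : ‖z‖ ≤ 1) {f : PowerSeries 𝕂} (hf : f ∈ TS 𝕂)
    (h0 : ev z f = 0) : ∃ h ∈ TS 𝕂, f = (PowerSeries.X - PowerSeries.C z) * h := by
  have hs : ∀ n, Summable (fun k => PowerSeries.coeff (n + k) f * z ^ k) := fun n => by
    apply summable_of_tendsto_zero
    refine tendsto_mul_pow ?_ hz
    have := (tendsto_add_atTop_iff_nat n).2 (mem_TS'.1 hf)
    simpa [add_comm] using this
  set H : ℕ → 𝕂 := fun n => ∑' k, PowerSeries.coeff (n + k) f * z ^ k with hH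
  have hrec : ∀ n, H n = PowerSeries.coeff n f + z * H (n + 1) := fun n => by
    simp only [hH]
    rw [(hs n).tsum_eq_zero_add, ← tsum_mul_left]
    simp only [add_zero, pow_zero, mul_one, pow_succ]
    congr 2
    ext k
    rw [show n + (k + 1) = n + 1 + k by ring]
    ring
  have hH0 : H 0 = 0 := by
    rw [← h0]; simp [hH, ev]
  refine ⟨PowerSeries.mk fun n => H (n + 1), ?_, ?_⟩
  · rw [mem_TS']
    simp only [PowerSeries.coeff_mk]
    have : Tendsto H atTop (nhds 0) := by
      have h1 := mem_TS'.1 hf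
      rw [Metric.tendsto_atTop] at h1 ⊢
      intro ε hε
      obtain ⟨N, hN⟩ := h1 (ε / 2) (by positivity)
      refine ⟨N, fun n hn => ?_⟩
      rw [dist_zero_right]
      refine lt_of_le_of_lt ?_ (half_lt_self hε)
      refine IsUltrametricDist.norm_tsum_le_of_forall_le_of_nonneg (by positivity) fun i => ?_
      rw [norm_mul, norm_pow]
      refine (mul_le_of_le_one_right (norm_nonneg _) (pow_le_one₀ (norm_nonneg _) hz)).trans ?_
      have := hN (n + i) (by omega)
      rw [dist_zero_right] at this
      exact this.le
    exact (tendsto_add_atTop_iff_nat 1).2 this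
  · ext n
    rw [sub_mul, map_sub, PowerSeries.coeff_C_mul, PowerSeries.coeff_mk]
    cases n with
    | zero =>
      rw [PowerSeries.coeff_zero_X_mul]
      have := hrec 0
      rw [hH0] at this
      linear_combination -this
    | succ n =>
      rw [PowerSeries.coeff_succ_X_mul, PowerSeries.coeff_mk]
      have := hrec (n + 1)
      linear_combination -this

end RAT


section RAT

set_option linter.unusedSectionVars false

variable {𝕂 : Type} [NontriviallyNormedField 𝕂]

theorem frob_pow {σ : 𝕂 →+* 𝕂} {q : ℕ} (hσ : ∀ x, σ x = x ^ q) (n : ℕ) (x : 𝕂) :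
    (σ ^ n) x = x ^ q ^ n := by
  induction n generalizing x with
  | zero => simp
  | succ n ih =>
    rw [pow_succ, RingHom.mul_def, RingHom.comp_apply, ih, hσ, ← pow_mul, pow_succ, mul_comm q]

theorem frob_pow_cont {σ : 𝕂 →+* 𝕂} {q : ℕ} (hσ : ∀ x, σ x = x ^ q) (n : ℕ) :
    Continuous (σ ^ n) := by
  have : (⇑(σ ^ n) : 𝕂 → 𝕂) = fun x => x ^ q ^ n := funext (frob_pow hσ n)
  rw [this]
  fun_prop

theorem frob_cont {σ : 𝕂 →+* 𝕂} {q : ℕ} (hσ : ∀ x, σ x = x ^ q) : Continuous σ := by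
  simpa using frob_pow_cont hσ 1

theorem norm_le_one_of_pow_eq {x : 𝕂} {n : ℕ} (hn : 2 ≤ n) (h : x ^ n = x) : ‖x‖ ≤ 1 := by
  by_contra hx
  push Not at hx
  have h1 : ‖x‖ ^ n = ‖x‖ := by rw [← norm_pow, h]
  have h2 : ‖x‖ ^ 1 < ‖x‖ ^ n := pow_lt_pow_right₀ hx (by omega)
  rw [h1, pow_one] at h2
  exact lt_irrefl _ h2

theorem eq_zero_of_pow_eq {x : 𝕂} {n : ℕ} (hn : 2 ≤ n) (h : x ^ n = x) (hx : ‖x‖ < 1) :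
    x = 0 := by
  by_contra hx0
  have h0 : 0 < ‖x‖ := norm_pos_iff.2 hx0
  have h1 : ‖x‖ ^ n = ‖x‖ := by rw [← norm_pow, h]
  have h2 : ‖x‖ ^ n < ‖x‖ ^ 1 := pow_lt_pow_right_of_lt_one₀ h0 hx (by omega)
  rw [h1, pow_one] at h2
  exact lt_irrefl _ h2

theorem two_le_qpow {q d : ℕ} (hq : 2 ≤ q) (hd : 0 < d) : 2 ≤ q ^ d :=
  hq.trans (Nat.le_self_pow (by omega) q)

theorem norm_le_one_of_periodic {σ : 𝕂 →+* 𝕂} {q : ℕ} (hq : 2 ≤ q) (hσ : ∀ x, σ x = x ^ q)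
    {d : ℕ} (hd : 0 < d) {z : 𝕂} (hz : (σ ^ d) z = z) : ‖z‖ ≤ 1 := by
  rw [frob_pow hσ] at hz
  exact norm_le_one_of_pow_eq (two_le_qpow hq hd) hz

theorem periodic_of_root {σ : 𝕂 →+* 𝕂} {a : Polynomial 𝕂} (ha : a ≠ 0) (hfix : a.map σ = a)
    {z : 𝕂} (hz : a.eval z = 0) : ∃ d, 0 < d ∧ (σ ^ d) z = z := by
  have hroot : ∀ n, a.eval ((σ ^ n) z) = 0 := by
    intro n
    induction n with
    | zero => simpa using hz
    | succ n ih =>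
      rw [pow_succ', RingHom.mul_def, RingHom.comp_apply]
      nth_rewrite 1 [← hfix]
      rw [Polynomial.eval_map, Polynomial.eval₂_hom, ih, map_zero]
  have : ¬ Function.Injective (fun n : ℕ => (σ ^ n) z) := by
    intro hinj
    have hf : Set.Finite (Set.range (fun n : ℕ => (σ ^ n) z)) := by
      refine (Polynomial.finite_setOfPred_isRoot ha).subset ?_
      rintro _ ⟨n, rfl⟩
      exact hroot n
    exact Set.infinite_range_of_injective hinj hf
  simp only [Function.Injective, not_forall] at this
  obtain ⟨m, n, hmn, hne⟩ := this
  have key : ∀ m n : ℕ, m < n → (σ ^ m) z = (σ ^ n) z → ∃ d, 0 < d ∧ (σ ^ d) z = z := by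
    intro m n hlt h
    refine ⟨n - m, by omega, ?_⟩
    have : n = m + (n - m) := by omega
    rw [this, pow_add, RingHom.mul_def, RingHom.comp_apply] at h
    exact ((σ ^ m).injective h).symm
  rcases lt_or_gt_of_ne hne with h | h
  · exact key m n h hmn
  · exact key n m h hmn.symm

theorem near_fixed [IsAlgClosed 𝕂] {q : ℕ} (hq : 2 ≤ q) {x : 𝕂}
    (h : ‖x ^ q - x‖ < 1) : ∃ a : 𝕂, a ^ q = a ∧ ‖x - a‖ < 1 := by
  set P : Polynomial 𝕂 := Polynomial.X ^ q - Polynomial.X with hP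
  have hm : P.Monic := by
    apply Polynomial.monic_X_pow_sub
    rw [Polynomial.degree_X]
    exact_mod_cast (by omega : 1 < q)
  have h1 := (IsAlgClosed.splits P).eval_eq_prod_roots_of_monic hm x
  have h2 : P.eval x = x ^ q - x := by simp [hP]
  by_contra hcon
  push Not at hcon
  have : 1 ≤ ‖P.eval x‖ := by
    rw [h1]
    have : ∀ s : Multiset 𝕂, (∀ a ∈ s, 1 ≤ ‖x - a‖) → 1 ≤ ‖(s.map fun a => x - a).prod‖ := by
      intro s
      induction s using Multiset.induction_on with
      | empty => simp
      | cons a s ih =>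
        intro hs
        rw [Multiset.map_cons, Multiset.prod_cons, norm_mul]
        exact one_le_mul_of_one_le_of_one_le (hs a (by simp)) (ih fun b hb => hs b (by simp [hb]))
    apply this
    intro a ha
    apply hcon
    have := Polynomial.isRoot_of_mem_roots ha
    simp only [hP, Polynomial.IsRoot, Polynomial.eval_sub, Polynomial.eval_pow,
      Polynomial.eval_X] at this
    exact sub_eq_zero.1 this
  rw [h2] at this
  linarith

variable [IsUltrametricDist 𝕂]

theorem nsub_le (x y : 𝕂) : ‖x - y‖ ≤ max ‖x‖ ‖y‖ := by
  rw [sub_eq_add_neg, ← norm_neg y]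
  exact IsUltrametricDist.norm_add_le_max _ _

theorem nsub_lt {x y : 𝕂} {c : ℝ} (hx : ‖x‖ < c) (hy : ‖y‖ < c) : ‖x - y‖ < c :=
  (nsub_le x y).trans_lt (max_lt hx hy)

/-- A sequence tending to zero with all terms of norm `< 1` is uniformly bounded by some `c < 1`. -/
theorem exists_unif {g : ℕ → 𝕂} (h : Tendsto g atTop (nhds 0)) (h1 : ∀ i, ‖g i‖ < 1) :
    ∃ c : ℝ, 0 ≤ c ∧ c < 1 ∧ ∀ i, ‖g i‖ ≤ c := by
  rw [Metric.tendsto_atTop] at h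
  obtain ⟨N, hN⟩ := h (1 / 2) (by norm_num)
  have : ∀ N : ℕ, ∃ c : ℝ, 0 ≤ c ∧ c < 1 ∧ ∀ i < N, ‖g i‖ ≤ c := by
    intro N
    induction N with
    | zero => exact ⟨0, le_rfl, one_pos, by simp⟩
    | succ N ih =>
      obtain ⟨c, hc0, hc1, hc⟩ := ih
      refine ⟨max c ‖g N‖, le_max_of_le_left hc0, max_lt hc1 (h1 N), fun i hi => ?_⟩
      rcases Nat.lt_succ_iff_lt_or_eq.1 hi with hi | rfl
      · exact le_max_of_le_left (hc i hi)
      · exact le_max_right _ _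
  obtain ⟨c, hc0, hc1, hc⟩ := this N
  refine ⟨max c (1 / 2), le_max_of_le_left hc0, max_lt hc1 (by norm_num), fun i => ?_⟩
  rcases lt_or_ge i N with hi | hi
  · exact le_max_of_le_left (hc i hi)
  · have := hN i hi
    rw [dist_zero_right] at this
    exact le_max_of_le_right this.le

end RAT


section RAT

set_option linter.unusedSectionVars false

variable {𝕂 : Type} [NontriviallyNormedField 𝕂] [IsUltrametricDist 𝕂] [CompleteSpace 𝕂]

theorem norm_one_sub {x : 𝕂} (hx : ‖x‖ < 1) : ‖1 - x‖ = 1 := by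
  have : ‖1 + -x‖ = max ‖(1 : 𝕂)‖ ‖-x‖ := by
    apply IsUltrametricDist.norm_add_eq_max_of_norm_ne_norm
    rw [norm_one, norm_neg]
    exact ne_of_gt hx
  rw [sub_eq_add_neg, this, norm_one, norm_neg]
  exact max_eq_left hx.le

/-- A series with unit constant coefficient, small higher coefficients, and satisfying the
functional equation is a unit of the Tate algebra. -/
theorem unit_case {q : ℕ} (hq : 2 ≤ q) {θ : 𝕂} (hθ : ‖θ‖ = (q : ℝ))
    {σ : 𝕂 →+* 𝕂} (hσ : ∀ x, σ x = x ^ q) {w : PowerSeries 𝕂}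
    (hFE : PowerSeries.map σ w = (1 - PowerSeries.C θ⁻¹ * PowerSeries.X) * w)
    (h0 : ‖PowerSeries.coeff 0 w‖ = 1) (h1 : ∀ i, 0 < i → ‖PowerSeries.coeff i w‖ < 1) :
    ∃ v ∈ TS 𝕂, w * v = 1 := by
  have hw0 : PowerSeries.constantCoeff w ≠ 0 := by
    intro h
    rw [PowerSeries.coeff_zero_eq_constantCoeff_apply, h, norm_zero] at h0
    exact zero_ne_one h0
  set v := w⁻¹ with hv
  have hwv : w * v = 1 := PowerSeries.mul_inv_cancel w hw0
  refine ⟨v, ?_, hwv⟩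
  have hcoef : ∀ n, 0 < n → PowerSeries.coeff 0 w * PowerSeries.coeff n v =
      -∑ i ∈ Finset.range n, PowerSeries.coeff (i + 1) w * PowerSeries.coeff (n - (i + 1)) v := by
    intro n hn
    have := congrArg (PowerSeries.coeff n) hwv
    rw [PowerSeries.coeff_mul, Finset.Nat.sum_antidiagonal_eq_sum_range_succ_mk,
      Finset.sum_range_succ', PowerSeries.coeff_one, if_neg (by omega)] at this
    simp only [Nat.sub_zero] at this
    linear_combination this
  have hb0 : ‖PowerSeries.coeff 0 v‖ = 1 := by
    have := congrArg (fun f => ‖PowerSeries.constantCoeff f‖) hwv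
    simp only [map_mul, map_one, norm_mul, norm_one] at this
    rw [PowerSeries.coeff_zero_eq_constantCoeff_apply] at h0 ⊢
    rw [h0, one_mul] at this
    exact this
  have hb : ∀ n, ‖PowerSeries.coeff n v‖ ≤ 1 ∧ (0 < n → ‖PowerSeries.coeff n v‖ < 1) := by
    intro n
    induction n using Nat.strong_induction_on with
    | _ n ih =>
      rcases Nat.eq_zero_or_pos n with rfl | hn
      · exact ⟨hb0.le, fun h => absurd h (lt_irrefl _)⟩
      · have hlt : ‖PowerSeries.coeff n v‖ < 1 := by
          have e := congrArg norm (hcoef n hn)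
          rw [norm_mul, h0, one_mul, norm_neg] at e
          rw [e]
          obtain ⟨i, hi, hle⟩ := IsUltrametricDist.exists_norm_finsetSum_le_of_nonempty
            (t := Finset.range n) ⟨0, by simpa using hn⟩
            (fun i => PowerSeries.coeff (i + 1) w * PowerSeries.coeff (n - (i + 1)) v)
          refine hle.trans_lt ?_
          rw [norm_mul]
          exact mul_lt_one_of_nonneg_of_lt_one_left (norm_nonneg _) (h1 _ (by omega))
            (ih _ (by omega)).1
        exact ⟨hlt.le, fun _ => hlt⟩
  -- functional equation for the inverse
  have hFEv : (1 - PowerSeries.C θ⁻¹ * PowerSeries.X) * PowerSeries.map σ v = v := by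
    have e1 : PowerSeries.map σ w * PowerSeries.map σ v = 1 := by
      rw [← map_mul, hwv, map_one]
    rw [hFE] at e1
    calc _ = (w * v) * ((1 - PowerSeries.C θ⁻¹ * PowerSeries.X) * PowerSeries.map σ v) := by
            rw [hwv, one_mul]
      _ = ((1 - PowerSeries.C θ⁻¹ * PowerSeries.X) * w * PowerSeries.map σ v) * v := by ring
      _ = v := by rw [e1, one_mul]
  have hq0 : (0 : ℝ) < q := by exact_mod_cast (by omega : 0 < q)
  have hstep : ∀ n, ‖PowerSeries.coeff (n + 1) v‖ ≤ (q : ℝ)⁻¹ * ‖PowerSeries.coeff n v‖ := by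
    intro n
    have e := congrArg (PowerSeries.coeff (n + 1)) hFEv
    rw [sub_mul, one_mul, map_sub, mul_assoc, PowerSeries.coeff_C_mul,
      PowerSeries.coeff_succ_X_mul, PowerSeries.coeff_map, PowerSeries.coeff_map, hσ, hσ] at e
    set y := PowerSeries.coeff (n + 1) v
    set x := PowerSeries.coeff n v with hx
    have hy : ‖y‖ < 1 := (hb (n + 1)).2 (by omega)
    have e2 : y * (1 - y ^ (q - 1)) = - (θ⁻¹ * x ^ q) := by
      have : y * y ^ (q - 1) = y ^ q := by rw [← pow_succ']; congr 1; omega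
      linear_combination -e - this
    have e3 := congrArg norm e2
    rw [norm_mul, norm_one_sub (by
      rw [norm_pow]; exact pow_lt_one₀ (norm_nonneg _) hy (by omega)), mul_one, norm_neg,
      norm_mul, norm_inv, hθ, norm_pow] at e3
    rw [e3]
    refine mul_le_mul_of_nonneg_left ?_ (by positivity)
    exact pow_le_of_le_one (norm_nonneg _) (hb n).1 (by omega)
  have hgeom : ∀ n, ‖PowerSeries.coeff n v‖ ≤ ((q : ℝ)⁻¹) ^ n := by
    intro n
    induction n with
    | zero => rw [pow_zero]; exact hb0.le
    | succ n ih =>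
      rw [pow_succ']
      exact (hstep n).trans (mul_le_mul_of_nonneg_left ih (by positivity))
  rw [mem_TS, IsTate]
  refine squeeze_zero (fun _ => norm_nonneg _) hgeom
    (tendsto_pow_atTop_nhds_zero_of_lt_one (by positivity) ?_)
  exact inv_lt_one_of_one_lt₀ (by exact_mod_cast (by omega : 1 < q))

theorem ev_orbit_zero {q : ℕ} (hq : 2 ≤ q) {θ : 𝕂} (hθ : ‖θ‖ = (q : ℝ))
    {σ : 𝕂 →+* 𝕂} (hσ : ∀ x, σ x = x ^ q) {w : PowerSeries 𝕂} (hw : w ∈ TS 𝕂)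
    (hFE : PowerSeries.map σ w = (1 - PowerSeries.C θ⁻¹ * PowerSeries.X) * w)
    {z : 𝕂} {d : ℕ} (hd : 0 < d) (hz : (σ ^ d) z = z) (hlt : ‖ev z w‖ < 1) : ev z w = 0 := by
  have hq1 : (1 : ℝ) < q := by exact_mod_cast (by omega : 1 < q)
  have hz1 := norm_le_one_of_periodic hq hσ hd hz
  have hn : ∀ n, ‖(σ ^ n) z‖ ≤ 1 := fun n => by
    rw [frob_pow hσ, norm_pow]; exact pow_le_one₀ (norm_nonneg _) hz1
  have hstep : ∀ n, ‖ev ((σ ^ (n + 1)) z) w‖ = ‖ev ((σ ^ n) z) w‖ ^ q := by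
    intro n
    have h1 := ev_map σ (frob_cont hσ) (hn n) hw
    have h2 : σ ((σ ^ n) z) = (σ ^ (n + 1)) z := by
      rw [pow_succ', RingHom.mul_def, RingHom.comp_apply]
    have hu : (1 - PowerSeries.C θ⁻¹ * PowerSeries.X : PowerSeries 𝕂) =
        ((1 - Polynomial.C θ⁻¹ * Polynomial.X : Polynomial 𝕂) : PowerSeries 𝕂) := by simp
    rw [h2, hFE, hσ, hu, ev_mul (hn _) (poly_mem_TS _) hw, ev_poly] at h1
    have h3 := congrArg norm h1
    rw [norm_mul, norm_pow] at h3
    simp only [Polynomial.eval_sub, Polynomial.eval_one, Polynomial.eval_mul, Polynomial.eval_C,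
      Polynomial.eval_X] at h3
    rw [norm_one_sub, one_mul] at h3
    · exact h3
    · rw [norm_mul, norm_inv, hθ]
      calc (q : ℝ)⁻¹ * ‖(σ ^ (n + 1)) z‖ ≤ (q : ℝ)⁻¹ * 1 :=
            mul_le_mul_of_nonneg_left (hn _) (by positivity)
        _ < 1 := by rw [mul_one]; exact inv_lt_one_of_one_lt₀ hq1
  have hall : ∀ n, ‖ev ((σ ^ n) z) w‖ = ‖ev z w‖ ^ q ^ n := by
    intro n
    induction n with
    | zero => simp
    | succ n ih => rw [hstep, ih, ← pow_mul, pow_succ]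
  have h := hall d
  rw [hz] at h
  by_contra hne
  have h0 : 0 < ‖ev z w‖ := norm_pos_iff.2 hne
  have := pow_lt_pow_right_of_lt_one₀ h0 hlt (lt_of_lt_of_le one_lt_two (two_le_qpow hq hd))
  rw [← h, pow_one] at this
  exact lt_irrefl _ this

theorem dichotomy [IsAlgClosed 𝕂] {q : ℕ} (hq : 2 ≤ q) {θ : 𝕂} (hθ : ‖θ‖ = (q : ℝ))
    {σ : 𝕂 →+* 𝕂} (hσ : ∀ x, σ x = x ^ q) {w : PowerSeries 𝕂} (hw : w ∈ TS 𝕂)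
    (hFE : PowerSeries.map σ w = (1 - PowerSeries.C θ⁻¹ * PowerSeries.X) * w) :
    (∃ v ∈ TS 𝕂, w * v = 1) ∨ ∃ z d, 0 < d ∧ (σ ^ d) z = z ∧ ev z w = 0 := by
  have hq1 : (1 : ℝ) < q := by exact_mod_cast (by omega : 1 < q)
  have hq0 : (0 : ℝ) < q := by linarith
  have c0 : PowerSeries.coeff 0 w ^ q = PowerSeries.coeff 0 w := by
    have e := congrArg (PowerSeries.coeff 0) hFE
    rw [sub_mul, one_mul, map_sub, mul_assoc, PowerSeries.coeff_C_mul,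
      PowerSeries.coeff_zero_X_mul, PowerSeries.coeff_map, hσ] at e
    simpa using e
  have cs : ∀ n, PowerSeries.coeff (n + 1) w ^ q =
      PowerSeries.coeff (n + 1) w - θ⁻¹ * PowerSeries.coeff n w := by
    intro n
    have e := congrArg (PowerSeries.coeff (n + 1)) hFE
    rwa [sub_mul, one_mul, map_sub, mul_assoc, PowerSeries.coeff_C_mul,
      PowerSeries.coeff_succ_X_mul, PowerSeries.coeff_map, hσ] at e
  have hle : ∀ n, ‖PowerSeries.coeff n w‖ ≤ 1 := by
    intro n
    induction n with
    | zero => exact norm_le_one_of_pow_eq hq c0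
    | succ n ih =>
      by_contra hx
      push Not at hx
      have h1 := congrArg norm (cs n)
      have h2 := nsub_le (PowerSeries.coeff (n + 1) w) (θ⁻¹ * PowerSeries.coeff n w)
      rw [← h1, norm_pow, norm_mul, norm_inv, hθ] at h2
      have h3 : (q : ℝ)⁻¹ * ‖PowerSeries.coeff n w‖ ≤ ‖PowerSeries.coeff (n + 1) w‖ := by
        have : (q : ℝ)⁻¹ * ‖PowerSeries.coeff n w‖ ≤ 1 :=
          mul_le_one₀ (inv_le_one_of_one_le₀ hq1.le) (norm_nonneg _) ih
        linarith
      rw [max_eq_left h3] at h2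
      have h4 : ‖PowerSeries.coeff (n + 1) w‖ ^ 1 < ‖PowerSeries.coeff (n + 1) w‖ ^ q :=
        pow_lt_pow_right₀ hx (by omega)
      rw [pow_one] at h4
      linarith
  have hnear : ∀ n, ‖PowerSeries.coeff n w ^ q - PowerSeries.coeff n w‖ < 1 := by
    intro n
    cases n with
    | zero => rw [c0, sub_self, norm_zero]; exact one_pos
    | succ n =>
      rw [cs, sub_sub_cancel_left, norm_neg, norm_mul, norm_inv, hθ]
      calc (q : ℝ)⁻¹ * ‖PowerSeries.coeff n w‖ ≤ (q : ℝ)⁻¹ * 1 :=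
            mul_le_mul_of_nonneg_left (hle _) (by positivity)
        _ < 1 := by rw [mul_one]; exact inv_lt_one_of_one_lt₀ hq1
  choose a ha1 ha2 using fun n => near_fixed hq (hnear n)
  have ha0 : ∀ n, ‖PowerSeries.coeff n w‖ < 1 → a n = 0 := by
    intro n hn
    apply eq_zero_of_pow_eq hq (ha1 n)
    have := nsub_lt hn (ha2 n)
    simpa using this
  obtain ⟨N, hN⟩ : ∃ N, ∀ n ≥ N, a n = 0 := by
    have := mem_TS'.1 hw
    rw [Metric.tendsto_atTop] at this
    obtain ⟨N, hN⟩ := this 1 one_pos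
    refine ⟨N, fun n hn => ha0 n ?_⟩
    simpa using hN n hn
  set P : Polynomial 𝕂 := ∑ i ∈ Finset.range N, Polynomial.monomial i (a i) with hP
  have hPc : ∀ n, P.coeff n = a n := by
    intro n
    rw [hP, Polynomial.finsetSum_coeff]
    simp only [Polynomial.coeff_monomial]
    rw [Finset.sum_ite_eq']
    split_ifs with h
    · rfl
    · rw [hN n (by simpa using h)]
  have hPfix : P.map σ = P := by
    ext n
    rw [Polynomial.coeff_map, hPc, hσ, ha1]
  by_cases hdeg : P.degree = 0
  · left
    have hP1 := Polynomial.eq_C_of_degree_eq_zero hdeg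
    rw [hPc] at hP1
    have ha : a 0 ≠ 0 := by
      intro h
      rw [hP1, h, Polynomial.C_0, Polynomial.degree_zero] at hdeg
      exact absurd hdeg (by simp)
    refine unit_case hq hθ hσ hFE ?_ ?_
    · refine le_antisymm (hle 0) ?_
      by_contra h
      exact ha (ha0 0 (not_le.1 h))
    · intro i hi
      have : a i = 0 := by
        rw [← hPc, hP1, Polynomial.coeff_C, if_neg (by omega)]
      simpa [this] using ha2 i
  · right
    obtain ⟨z, hz⟩ := IsAlgClosed.exists_root P hdeg
    by_cases hP0 : P = 0
    · have hlt : ∀ n, ‖PowerSeries.coeff n w‖ < 1 := by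
        intro n
        have : a n = 0 := by rw [← hPc, hP0, Polynomial.coeff_zero]
        simpa [this] using ha2 n
      have hw0 : w = 0 := by
        ext n
        induction n with
        | zero => exact eq_zero_of_pow_eq hq c0 (hlt 0)
        | succ n ih =>
          apply eq_zero_of_pow_eq hq _ (hlt _)
          rw [cs, ih]; simp
      refine ⟨0, 1, one_pos, by simp, ?_⟩
      rw [hw0]
      simpa using ev_C (0 : 𝕂) 0
    · obtain ⟨d, hd, hzd⟩ := periodic_of_root hP0 hPfix hz
      refine ⟨z, d, hd, hzd, ?_⟩
      have hz1 := norm_le_one_of_periodic hq hσ hd hzd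
      apply ev_orbit_zero hq hθ hσ hw hFE hd hzd
      have hsub : w - (P : PowerSeries 𝕂) ∈ TS 𝕂 := Subring.sub_mem _ hw (poly_mem_TS P)
      have h1 : ev z w = ev z (w - (P : PowerSeries 𝕂)) := by
        have : ev z w = ev z (w - (P : PowerSeries 𝕂) + P) := by rw [sub_add_cancel]
        rw [this, ev_add hz1 hsub (poly_mem_TS P), ev_poly, hz, add_zero]
      obtain ⟨c, hc0, hc1, hc⟩ := exists_unif (mem_TS'.1 hsub) (fun i => by
        rw [map_sub, Polynomial.coeff_coe, hPc]; exact ha2 i)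
      rw [h1]
      exact (norm_ev_le hz1 hc0 hc).trans_lt hc1

end RAT


section RAT

set_option linter.unusedSectionVars false

variable {𝕂 : Type} [NontriviallyNormedField 𝕂]

/-- The operator `f ↦ θ f + ∑ A_i f^{(i)}`. -/
def Lop (r : ℕ) (θ : 𝕂) (A : ℕ → 𝕂) (σ : 𝕂 →+* 𝕂) (f : PowerSeries 𝕂) : PowerSeries 𝕂 :=
  PowerSeries.C θ * f + ∑ i ∈ Finset.Icc 1 r, PowerSeries.C (A i) * PowerSeries.map (σ ^ i) f

theorem coeff_Lop {r q : ℕ} {θ : 𝕂} {A : ℕ → 𝕂} {σ : 𝕂 →+* 𝕂} (hσ : ∀ x, σ x = x ^ q)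
    (f : PowerSeries 𝕂) (n : ℕ) :
    PowerSeries.coeff n (Lop r θ A σ f) = phiT 𝕂 q r θ A (PowerSeries.coeff n f) := by
  simp [Lop, phiT, frob_pow hσ]

theorem map_pow_fix {σ : 𝕂 →+* 𝕂} {a : Polynomial 𝕂} (ha : a.map σ = a) (n : ℕ) :
    PowerSeries.map (σ ^ n) (a : PowerSeries 𝕂) = a := by
  ext k
  rw [PowerSeries.coeff_map, Polynomial.coeff_coe]
  have h1 : σ (a.coeff k) = a.coeff k := by
    nth_rewrite 2 [← ha]; rw [Polynomial.coeff_map]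
  induction n with
  | zero => simp
  | succ n ih => rw [pow_succ, RingHom.mul_def, RingHom.comp_apply, h1, ih]

theorem Lop_poly_mul {r : ℕ} {θ : 𝕂} {A : ℕ → 𝕂} {σ : 𝕂 →+* 𝕂} {a : Polynomial 𝕂}
    (ha : a.map σ = a) (f : PowerSeries 𝕂) :
    Lop r θ A σ ((a : PowerSeries 𝕂) * f) = a * Lop r θ A σ f := by
  unfold Lop
  simp only [map_mul, map_pow_fix ha]
  rw [mul_add, Finset.mul_sum]
  congr 1
  · ring
  · refine Finset.sum_congr rfl fun i _ => ?_
    ring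

theorem Lop_sum {ι : Type*} (s : Finset ι) {r : ℕ} {θ : 𝕂} {A : ℕ → 𝕂} {σ : 𝕂 →+* 𝕂}
    (f : ι → PowerSeries 𝕂) :
    Lop r θ A σ (∑ j ∈ s, f j) = ∑ j ∈ s, Lop r θ A σ (f j) := by
  unfold Lop
  rw [Finset.sum_add_distrib, Finset.mul_sum, Finset.sum_comm]
  congr 1
  refine Finset.sum_congr rfl fun i _ => ?_
  rw [map_sum, Finset.mul_sum]

variable {q : ℕ} {σ : 𝕂 →+* 𝕂} {α : ℕ → 𝕂}

theorem exp_add (hσ : ∀ x, σ x = x ^ q) (hs : ∀ z : 𝕂, Summable fun n => α n * z ^ q ^ n)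
    (x y : 𝕂) : expF 𝕂 q α (x + y) = expF 𝕂 q α x + expF 𝕂 q α y := by
  unfold expF
  rw [← (hs x).tsum_add (hs y)]
  congr 1
  ext n
  rw [← frob_pow hσ, ← frob_pow hσ, ← frob_pow hσ, map_add, mul_add]

theorem exp_smul {c : 𝕂} (hc : c ^ q = c) (x : 𝕂) :
    expF 𝕂 q α (c * x) = c * expF 𝕂 q α x := by
  unfold expF
  rw [← tsum_mul_left]
  congr 1
  ext n
  have : c ^ q ^ n = c := by
    induction n with
    | zero => simp
    | succ n ih => rw [pow_succ, pow_mul, ih, hc]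
  rw [mul_pow, this]
  ring

theorem exp_zero' (hq : 2 ≤ q) : expF 𝕂 q α 0 = 0 := by
  have := exp_smul (q := q) (α := α) (c := (0 : 𝕂)) (by rw [zero_pow (by omega)]) 0
  simpa using this

theorem exp_sub (hσ : ∀ x, σ x = x ^ q) (hs : ∀ z : 𝕂, Summable fun n => α n * z ^ q ^ n)
    (x y : 𝕂) : expF 𝕂 q α (x - y) = expF 𝕂 q α x - expF 𝕂 q α y := by
  have := exp_add hσ hs (x - y) y
  rw [sub_add_cancel] at this
  rw [this, add_sub_cancel_right]

theorem exp_sum {ι : Type*} (s : Finset ι) (hq : 2 ≤ q) (hσ : ∀ x, σ x = x ^ q)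
    (hs : ∀ z : 𝕂, Summable fun n => α n * z ^ q ^ n)
    (x : ι → 𝕂) : expF 𝕂 q α (∑ i ∈ s, x i) = ∑ i ∈ s, expF 𝕂 q α (x i) := by
  classical
  induction s using Finset.induction_on with
  | empty => simpa using exp_zero' hq
  | insert a s ha ih => rw [Finset.sum_insert ha, Finset.sum_insert ha, exp_add hσ hs, ih]

variable [IsUltrametricDist 𝕂]

theorem exp_quad (hq : 2 ≤ q) (hα0 : α 0 = 1)
    (hs : ∀ z : 𝕂, Summable fun n => α n * z ^ q ^ n) :
    ∃ C : ℝ, 0 < C ∧ ∀ z : 𝕂, ‖z‖ ≤ 1 → ‖expF 𝕂 q α z - z‖ ≤ C * ‖z‖ ^ 2 := by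
  have h1 := (hs 1).tendsto_atTop_zero
  simp only [one_pow, mul_one] at h1
  obtain ⟨C, hC⟩ := (Metric.isBounded_range_of_tendsto _ h1).exists_norm_le
  have hC' : ∀ n, ‖α n‖ ≤ |C| + 1 := fun n =>
    (hC _ ⟨n, rfl⟩).trans ((le_abs_self C).trans (by linarith))
  refine ⟨|C| + 1, by positivity, fun z hz => ?_⟩
  have : expF 𝕂 q α z - z = ∑' n, α (n + 1) * z ^ q ^ (n + 1) := by
    unfold expF
    rw [(hs z).tsum_eq_zero_add, hα0]
    simp
  rw [this]
  refine IsUltrametricDist.norm_tsum_le_of_forall_le_of_nonneg (by positivity) fun n => ?_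
  rw [norm_mul, norm_pow]
  refine mul_le_mul (hC' _) ?_ (by positivity) (by positivity)
  exact pow_le_pow_of_le_one (norm_nonneg _) hz (two_le_qpow hq (by omega))

theorem exp_isometry (hq : 2 ≤ q) (hα0 : α 0 = 1)
    (hs : ∀ z : 𝕂, Summable fun n => α n * z ^ q ^ n) :
    ∃ ε : ℝ, 0 < ε ∧ ∀ z : 𝕂, ‖z‖ < ε → ‖expF 𝕂 q α z‖ = ‖z‖ := by
  obtain ⟨C, hC0, hC⟩ := exp_quad hq hα0 hs
  refine ⟨min 1 C⁻¹, by positivity, fun z hz => ?_⟩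
  rcases eq_or_ne z 0 with rfl | hz0
  · rw [exp_zero' hq]
  have hz1 : ‖z‖ ≤ 1 := (hz.trans_le (min_le_left _ _)).le
  have hz2 : ‖z‖ < C⁻¹ := hz.trans_le (min_le_right _ _)
  have hpos : 0 < ‖z‖ := norm_pos_iff.2 hz0
  have h1 : ‖expF 𝕂 q α z - z‖ < ‖z‖ := by
    refine (hC z hz1).trans_lt ?_
    have : C * ‖z‖ < 1 := by
      calc C * ‖z‖ < C * C⁻¹ := mul_lt_mul_of_pos_left hz2 hC0
        _ = 1 := mul_inv_cancel₀ hC0.ne'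
    calc C * ‖z‖ ^ 2 = (C * ‖z‖) * ‖z‖ := by ring
      _ < 1 * ‖z‖ := mul_lt_mul_of_pos_right this hpos
      _ = ‖z‖ := one_mul _
  have h2 : ‖(expF 𝕂 q α z - z) + z‖ = max ‖expF 𝕂 q α z - z‖ ‖z‖ :=
    IsUltrametricDist.norm_add_eq_max_of_norm_ne_norm h1.ne
  rw [sub_add_cancel, max_eq_right h1.le] at h2
  exact h2

theorem exp_strict (hq : 2 ≤ q) (hα0 : α 0 = 1) (hσ : ∀ x, σ x = x ^ q)
    (hs : ∀ z : 𝕂, Summable fun n => α n * z ^ q ^ n) :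
    HasStrictDerivAt (expF 𝕂 q α) 1 0 := by
  obtain ⟨C, hC0, hC⟩ := exp_quad hq hα0 hs
  rw [hasStrictDerivAt_iff_hasStrictFDerivAt]
  refine .of_isLittleO ?_
  rw [Asymptotics.isLittleO_iff]
  intro c hc
  have hcont : Tendsto (fun p : 𝕂 × 𝕂 => p.1 - p.2) (nhds (0, 0)) (nhds 0) := by
    have : Continuous (fun p : 𝕂 × 𝕂 => p.1 - p.2) := by fun_prop
    simpa using this.tendsto (0, 0)
  have hball := hcont (Metric.ball_mem_nhds (0 : 𝕂) (ε := min 1 (c / C)) (by positivity))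
  filter_upwards [hball] with p hp
  have hp' : ‖p.1 - p.2‖ < min 1 (c / C) := by simpa using hp
  have h1 := hC (p.1 - p.2) (hp'.trans_le (min_le_left _ _)).le
  rw [exp_sub hσ hs] at h1
  have e : (ContinuousLinearMap.toSpanSingleton 𝕂 (1 : 𝕂)) (p.1 - p.2) = p.1 - p.2 := by simp
  rw [e]
  refine h1.trans ?_
  rw [pow_two, ← mul_assoc]
  refine mul_le_mul_of_nonneg_right ?_ (norm_nonneg _)
  have := (hp'.trans_le (min_le_right _ _)).le
  rw [le_div_iff₀ hC0] at this
  linarith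

variable {θ : 𝕂} {r : ℕ} {A : ℕ → 𝕂}

theorem theta_ne (hq : 2 ≤ q) (hθ : ‖θ‖ = (q : ℝ)) : θ ≠ 0 := by
  intro h
  rw [h, norm_zero] at hθ
  have : (q : ℝ) ≠ 0 := by exact_mod_cast (by omega : q ≠ 0)
  exact this hθ.symm

theorem tendsto_div_theta (hq : 2 ≤ q) (hθ : ‖θ‖ = (q : ℝ)) (u : 𝕂) :
    Tendsto (fun m : ℕ => u / θ ^ (m + 1)) atTop (nhds 0) := by
  have h : Tendsto (fun m : ℕ => (θ⁻¹) ^ (m + 1)) atTop (nhds 0) := by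
    refine (tendsto_add_atTop_iff_nat 1).2 (tendsto_pow_atTop_nhds_zero_of_norm_lt_one ?_)
    rw [norm_inv, hθ]
    exact inv_lt_one_of_one_lt₀ (by exact_mod_cast (by omega : 1 < q))
  simpa [div_eq_mul_inv] using h.const_mul u

theorem agf_mem (hq : 2 ≤ q) (hα0 : α 0 = 1) (hσ : ∀ x, σ x = x ^ q)
    (hs : ∀ z : 𝕂, Summable fun n => α n * z ^ q ^ n) (hθ : ‖θ‖ = (q : ℝ)) (u : 𝕂) :
    AGF 𝕂 q α θ u ∈ TS 𝕂 := by
  rw [mem_TS']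
  simp only [AGF, PowerSeries.coeff_mk]
  have h := (HasStrictDerivAt.hasDerivAt (exp_strict hq hα0 hσ hs)).continuousAt.tendsto
  rw [exp_zero' hq] at h
  exact h.comp (tendsto_div_theta hq hθ u)

theorem exp_div_step (hq : 2 ≤ q) (hθ : ‖θ‖ = (q : ℝ))
    (hFE : ∀ z : 𝕂, expF 𝕂 q α (θ * z) = phiT 𝕂 q r θ A (expF 𝕂 q α z)) (u : 𝕂) (m : ℕ) :
    phiT 𝕂 q r θ A (expF 𝕂 q α (u / θ ^ (m + 1))) = expF 𝕂 q α (u / θ ^ m) := by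
  have hne := theta_ne hq hθ
  rw [← hFE]
  congr 1
  field_simp
  ring

theorem agf_FE (hq : 2 ≤ q) (hσ : ∀ x, σ x = x ^ q) (hθ : ‖θ‖ = (q : ℝ))
    (hFE : ∀ z : 𝕂, expF 𝕂 q α (θ * z) = phiT 𝕂 q r θ A (expF 𝕂 q α z)) {u : 𝕂}
    (hu : expF 𝕂 q α u = 0) :
    Lop r θ A σ (AGF 𝕂 q α θ u) = PowerSeries.X * AGF 𝕂 q α θ u := by
  ext n
  rw [coeff_Lop hσ]
  simp only [AGF, PowerSeries.coeff_mk]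
  rw [exp_div_step hq hθ hFE]
  cases n with
  | zero => rw [PowerSeries.coeff_zero_X_mul]; simpa using hu
  | succ n => rw [PowerSeries.coeff_succ_X_mul, PowerSeries.coeff_mk]

theorem agf_add (hσ : ∀ x, σ x = x ^ q) (hs : ∀ z : 𝕂, Summable fun n => α n * z ^ q ^ n)
    (u v : 𝕂) : AGF 𝕂 q α θ (u + v) = AGF 𝕂 q α θ u + AGF 𝕂 q α θ v := by
  ext n
  simp only [AGF, PowerSeries.coeff_mk, map_add]
  rw [add_div, exp_add hσ hs]

theorem agf_sum {ι : Type*} (s : Finset ι) (hq : 2 ≤ q) (hσ : ∀ x, σ x = x ^ q)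
    (hs : ∀ z : 𝕂, Summable fun n => α n * z ^ q ^ n)
    (x : ι → 𝕂) : AGF 𝕂 q α θ (∑ i ∈ s, x i) = ∑ i ∈ s, AGF 𝕂 q α θ (x i) := by
  ext n
  simp only [AGF, PowerSeries.coeff_mk, map_sum]
  rw [Finset.sum_div, exp_sum s hq hσ hs]

theorem agf_smul {c : 𝕂} (hc : c ^ q = c) (u : 𝕂) :
    AGF 𝕂 q α θ (c * u) = PowerSeries.C c * AGF 𝕂 q α θ u := by
  ext n
  rw [PowerSeries.coeff_C_mul]
  simp only [AGF, PowerSeries.coeff_mk]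
  rw [mul_div_assoc, exp_smul hc]

theorem agf_theta (hq : 2 ≤ q) (hθ : ‖θ‖ = (q : ℝ)) {u : 𝕂} (hu : expF 𝕂 q α u = 0) :
    AGF 𝕂 q α θ (θ * u) = PowerSeries.X * AGF 𝕂 q α θ u := by
  have hne := theta_ne hq hθ
  ext n
  have h : θ * u / θ ^ (n + 1) = u / θ ^ n := by field_simp; ring
  cases n with
  | zero =>
    rw [PowerSeries.coeff_zero_X_mul]
    simp only [AGF, PowerSeries.coeff_mk]
    rw [h]; simpa using hu
  | succ n =>
    rw [PowerSeries.coeff_succ_X_mul]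
    simp only [AGF, PowerSeries.coeff_mk]
    rw [h]

theorem exp_theta_pow (hq : 2 ≤ q)
    (hFE : ∀ z : 𝕂, expF 𝕂 q α (θ * z) = phiT 𝕂 q r θ A (expF 𝕂 q α z)) {u : 𝕂}
    (hu : expF 𝕂 q α u = 0) (n : ℕ) : expF 𝕂 q α (θ ^ n * u) = 0 := by
  induction n with
  | zero => simpa using hu
  | succ n ih =>
    rw [pow_succ', mul_assoc, hFE, ih, phiT, mul_zero, zero_add]
    refine Finset.sum_eq_zero fun i hi => ?_
    rw [zero_pow (pow_ne_zero _ (by omega)), mul_zero]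

theorem agf_poly (hq : 2 ≤ q) (hσ : ∀ x, σ x = x ^ q) (hθ : ‖θ‖ = (q : ℝ))
    (hs : ∀ z : 𝕂, Summable fun n => α n * z ^ q ^ n)
    (hFE : ∀ z : 𝕂, expF 𝕂 q α (θ * z) = phiT 𝕂 q r θ A (expF 𝕂 q α z)) {u : 𝕂}
    (hu : expF 𝕂 q α u = 0) {a : Polynomial 𝕂} (ha : a.map σ = a) :
    AGF 𝕂 q α θ (a.eval θ * u) = (a : PowerSeries 𝕂) * AGF 𝕂 q α θ u := by
  have hpow : ∀ n, AGF 𝕂 q α θ (θ ^ n * u) = PowerSeries.X ^ n * AGF 𝕂 q α θ u := by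
    intro n
    induction n with
    | zero => simp
    | succ n ih =>
      rw [pow_succ', mul_assoc, agf_theta hq hθ (exp_theta_pow hq hFE hu n), ih, pow_succ',
        mul_assoc]
  have hc : ∀ n, a.coeff n ^ q = a.coeff n := fun n => by
    rw [← hσ, ← Polynomial.coeff_map, ha]
  have hcoe : (a : PowerSeries 𝕂) = ∑ i ∈ Finset.range (a.natDegree + 1),
      PowerSeries.C (a.coeff i) * PowerSeries.X ^ i := by
    conv_lhs => rw [a.as_sum_range_C_mul_X_pow]
    rw [← Polynomial.coeToPowerSeries.ringHom_apply, map_sum]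
    simp
  rw [Polynomial.eval_eq_sum_range, Finset.sum_mul, agf_sum _ hq hσ hs, hcoe, Finset.sum_mul]
  refine Finset.sum_congr rfl fun i _ => ?_
  rw [mul_assoc, agf_smul (hc i), hpow, mul_assoc]

theorem agf_inj (hq : 2 ≤ q) (hα0 : α 0 = 1) (hθ : ‖θ‖ = (q : ℝ))
    (hs : ∀ z : 𝕂, Summable fun n => α n * z ^ q ^ n) {u : 𝕂}
    (h : AGF 𝕂 q α θ u = 0) : u = 0 := by
  obtain ⟨ε, hε, hiso⟩ := exp_isometry hq hα0 hs
  have ht := tendsto_div_theta hq hθ u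
  rw [Metric.tendsto_atTop] at ht
  obtain ⟨N, hN⟩ := ht ε hε
  have h1 := hiso (u / θ ^ (N + 1)) (by
    have := hN N le_rfl
    rwa [dist_zero_right] at this)
  have h2 := congrArg (PowerSeries.coeff N) h
  simp only [AGF, PowerSeries.coeff_mk, map_zero] at h2
  rw [h2, norm_zero] at h1
  have h3 := norm_eq_zero.1 h1.symm
  rcases div_eq_zero_iff.1 h3 with h | h
  · exact h
  · exact absurd h (pow_ne_zero _ (theta_ne hq hθ))

theorem agf_surj [CompleteSpace 𝕂] (hq : 2 ≤ q) (hα0 : α 0 = 1) (hσ : ∀ x, σ x = x ^ q)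
    (hθ : ‖θ‖ = (q : ℝ)) (hs : ∀ z : 𝕂, Summable fun n => α n * z ^ q ^ n)
    (hFE : ∀ z : 𝕂, expF 𝕂 q α (θ * z) = phiT 𝕂 q r θ A (expF 𝕂 q α z))
    {h : PowerSeries 𝕂} (hh : h ∈ TS 𝕂) (hL : Lop r θ A σ h = PowerSeries.X * h) :
    ∃ u, expF 𝕂 q α u = 0 ∧ h = AGF 𝕂 q α θ u := by
  have hne := theta_ne hq hθ
  have hq0 : (0 : ℝ) < q := by exact_mod_cast (by omega : 0 < q)
  obtain ⟨ε, hε, hiso⟩ := exp_isometry hq hα0 hs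
  have hinj : ∀ x y : 𝕂, ‖x‖ < ε → ‖y‖ < ε → expF 𝕂 q α x = expF 𝕂 q α y → x = y := by
    intro x y hx hy hxy
    have := hiso (x - y) (nsub_lt hx hy)
    rw [exp_sub hσ hs, hxy, sub_self, norm_zero] at this
    exact sub_eq_zero.1 (norm_eq_zero.1 this.symm)
  have hr0 : phiT 𝕂 q r θ A (PowerSeries.coeff 0 h) = 0 := by
    have := congrArg (PowerSeries.coeff 0) hL
    rwa [coeff_Lop hσ, PowerSeries.coeff_zero_X_mul] at this
  have hrs : ∀ n, phiT 𝕂 q r θ A (PowerSeries.coeff (n + 1) h) = PowerSeries.coeff n h := by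
    intro n
    have := congrArg (PowerSeries.coeff (n + 1)) hL
    rwa [coeff_Lop hσ, PowerSeries.coeff_succ_X_mul] at this
  have hmap := (exp_strict hq hα0 hσ hs).map_nhds_eq one_ne_zero
  rw [exp_zero' hq] at hmap
  have him : expF 𝕂 q α '' (Metric.ball 0 (min ε (ε / q))) ∈ nhds (0 : 𝕂) := by
    rw [← hmap]
    exact image_mem_map (Metric.ball_mem_nhds _ (by positivity))
  obtain ⟨N, hN⟩ := eventually_atTop.1 (mem_TS'.1 hh him)
  choose! z hz using hN
  have hz1 : ∀ m ≥ N, ‖z m‖ < ε := fun m hm => by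
    have := (hz m hm).1
    rw [mem_ball_zero_iff] at this
    exact this.trans_le (min_le_left _ _)
  have hz2 : ∀ m ≥ N, ‖θ * z m‖ < ε := fun m hm => by
    have := (hz m hm).1
    rw [mem_ball_zero_iff] at this
    have := this.trans_le (min_le_right _ _)
    rw [norm_mul, hθ]
    rwa [lt_div_iff₀ hq0, mul_comm] at this
  have hzrec : ∀ m ≥ N, θ * z (m + 1) = z m := fun m hm => by
    refine hinj _ _ (hz2 _ (by omega)) (hz1 m hm) ?_
    rw [hFE, (hz (m + 1) (by omega)).2, hrs, (hz m hm).2]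
  set u := θ ^ (N + 1) * z N with hu
  have hzu : ∀ k, z (N + k) = u / θ ^ (N + k + 1) := by
    intro k
    induction k with
    | zero => rw [hu]; field_simp; simp
    | succ k ih =>
      have := hzrec (N + k) (by omega)
      rw [ih] at this
      rw [← add_assoc, pow_succ, ← div_div, ← this]
      field_simp
  have hbig : ∀ m ≥ N, PowerSeries.coeff m h = expF 𝕂 q α (u / θ ^ (m + 1)) := fun m hm => by
    obtain ⟨k, rfl⟩ := Nat.exists_eq_add_of_le hm
    rw [← hzu, (hz _ hm).2]
  have hdown : ∀ m, PowerSeries.coeff m h = expF 𝕂 q α (u / θ ^ (m + 1)) →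
      ∀ k ≤ m, PowerSeries.coeff k h = expF 𝕂 q α (u / θ ^ (k + 1)) := by
    intro m
    induction m with
    | zero => intro h0 k hk; rw [Nat.le_zero.1 hk]; exact h0
    | succ m ih =>
      intro hm k hk
      rcases Nat.le_succ_iff.1 hk with hk | rfl
      · refine ih ?_ k hk
        rw [← hrs, hm, exp_div_step hq hθ hFE]
      · exact hm
  have hall : ∀ m, PowerSeries.coeff m h = expF 𝕂 q α (u / θ ^ (m + 1)) := fun m =>
    hdown (max m N) (hbig _ (le_max_right _ _)) m (le_max_left _ _)
  refine ⟨u, ?_, ?_⟩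
  · have := hr0
    rw [hall, exp_div_step hq hθ hFE] at this
    simpa using this
  · ext m
    rw [hall]; simp [AGF]

end RAT


section RAT

set_option linter.unusedSectionVars false

variable {𝕂 : Type} [NontriviallyNormedField 𝕂]

theorem sp_add (σ : 𝕂 →+* 𝕂) (m n : ℕ) (x : 𝕂) : (σ ^ (m + n)) x = (σ ^ m) ((σ ^ n) x) := by
  rw [pow_add, RingHom.mul_def, RingHom.comp_apply]

theorem map_sp_add (σ : 𝕂 →+* 𝕂) (m n : ℕ) (f : PowerSeries 𝕂) :
    PowerSeries.map (σ ^ (m + n)) f = PowerSeries.map (σ ^ m) (PowerSeries.map (σ ^ n) f) := by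
  ext k
  simp only [PowerSeries.coeff_map]
  exact sp_add σ m n _

variable {q : ℕ} {σ : 𝕂 →+* 𝕂} {α : ℕ → 𝕂} {θ : 𝕂} {r : ℕ} {A : ℕ → 𝕂}

theorem asub_poly (hσ : ∀ x, σ x = x ^ q) {x : 𝕂} (hx : x ∈ Asubring 𝕂 q θ) :
    ∃ a : Polynomial 𝕂, a.map σ = a ∧ a.eval θ = x := by
  unfold Asubring at hx
  induction hx using Subring.closure_induction with
  | mem x hx =>
    rcases hx with hx | hx
    · rw [Set.mem_singleton_iff] at hx
      exact ⟨Polynomial.X, by simp, by simp [hx]⟩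
    · exact ⟨Polynomial.C x, by rw [Polynomial.map_C, hσ, hx], by simp⟩
  | zero => exact ⟨0, by simp, by simp⟩
  | one => exact ⟨1, by simp, by simp⟩
  | add x y _ _ hx hy =>
    obtain ⟨a, ha, rfl⟩ := hx
    obtain ⟨b, hb, rfl⟩ := hy
    exact ⟨a + b, by rw [Polynomial.map_add, ha, hb], by simp⟩
  | neg x _ hx =>
    obtain ⟨a, ha, rfl⟩ := hx
    exact ⟨-a, by rw [Polynomial.map_neg, ha], by simp⟩
  | mul x y _ _ hx hy =>
    obtain ⟨a, ha, rfl⟩ := hx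
    obtain ⟨b, hb, rfl⟩ := hy
    exact ⟨a * b, by rw [Polynomial.map_mul, ha, hb], by simp⟩

theorem poly_asub (hσ : ∀ x, σ x = x ^ q) {a : Polynomial 𝕂} (ha : a.map σ = a) :
    a.eval θ ∈ Asubring 𝕂 q θ := by
  have hc : ∀ n, a.coeff n ^ q = a.coeff n := fun n => by
    rw [← hσ, ← Polynomial.coeff_map, ha]
  rw [Polynomial.eval_eq_sum_range]
  refine Subring.sum_mem _ fun i _ => Subring.mul_mem _ ?_ (Subring.pow_mem _ ?_ _)
  · exact Subring.subset_closure (Or.inr (hc i))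
  · exact Subring.subset_closure (Or.inl rfl)

variable [IsUltrametricDist 𝕂]

theorem theta_transc [IsAlgClosed 𝕂] [CompleteSpace 𝕂] (hq : 2 ≤ q) (hσ : ∀ x, σ x = x ^ q)
    (hθ : ‖θ‖ = (q : ℝ))
    {a : Polynomial 𝕂} (ha : a.map σ = a) (h0 : a.eval θ = 0) : a = 0 := by
  by_contra hne
  obtain ⟨d, hd, hz⟩ := periodic_of_root hne ha h0
  have := norm_le_one_of_periodic hq hσ hd hz
  rw [hθ] at this
  have h2 : (2 : ℝ) ≤ q := by exact_mod_cast hq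
  linarith

theorem gen_of_basis [CompleteSpace 𝕂] (hq : 2 ≤ q) (hα0 : α 0 = 1) (hσ : ∀ x, σ x = x ^ q)
    (hθ : ‖θ‖ = (q : ℝ)) (hs : ∀ z : 𝕂, Summable fun n => α n * z ^ q ^ n)
    (hFE : ∀ z : 𝕂, expF 𝕂 q α (θ * z) = phiT 𝕂 q r θ A (expF 𝕂 q α z))
    {π : Fin r → 𝕂} (hπ : IsPeriodBasis 𝕂 q r α θ π)
    {h : PowerSeries 𝕂} (hh : h ∈ TS 𝕂) (hL : Lop r θ A σ h = PowerSeries.X * h) :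
    ∃ c : Fin r → Polynomial 𝕂, (∀ j, (c j).map σ = c j) ∧
      h = ∑ j, (c j : PowerSeries 𝕂) * AGF 𝕂 q α θ (π j) := by
  obtain ⟨u, hu, rfl⟩ := agf_surj hq hα0 hσ hθ hs hFE hh hL
  obtain ⟨a, ⟨ha, hua⟩, -⟩ := hπ.2 u hu
  choose c hc hca using fun j => asub_poly hσ (ha j)
  refine ⟨c, hc, ?_⟩
  rw [hua, agf_sum _ hq hσ hs]
  refine Finset.sum_congr rfl fun j _ => ?_
  rw [← hca, agf_poly hq hσ hθ hs hFE (hπ.1 j) (hc j)]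

theorem ind_of_basis [IsAlgClosed 𝕂] [CompleteSpace 𝕂] (hq : 2 ≤ q) (hα0 : α 0 = 1)
    (hσ : ∀ x, σ x = x ^ q)
    (hθ : ‖θ‖ = (q : ℝ)) (hs : ∀ z : 𝕂, Summable fun n => α n * z ^ q ^ n)
    (hFE : ∀ z : 𝕂, expF 𝕂 q α (θ * z) = phiT 𝕂 q r θ A (expF 𝕂 q α z))
    {π : Fin r → 𝕂} (hπ : IsPeriodBasis 𝕂 q r α θ π)
    (a : Fin r → Polynomial 𝕂) (ha : ∀ j, (a j).map σ = a j)
    (h0 : ∑ j, (a j : PowerSeries 𝕂) * AGF 𝕂 q α θ (π j) = 0) (j : Fin r) : a j = 0 := by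
  have hu : ∑ j, (a j).eval θ * π j = 0 := by
    refine agf_inj hq hα0 hθ hs ?_
    rw [agf_sum _ hq hσ hs, ← h0]
    refine Finset.sum_congr rfl fun j _ => ?_
    rw [agf_poly hq hσ hθ hs hFE (hπ.1 j) (ha j)]
  have huniq := (hπ.2 0 (exp_zero' hq)).unique
    (y₁ := fun j => (a j).eval θ) (y₂ := fun _ => 0)
    ⟨fun j => poly_asub hσ (ha j), hu.symm⟩ ⟨fun j => Subring.zero_mem _, by simp⟩
  exact theta_transc hq hσ hθ (ha j) (congrFun huniq j)

/-- The core contradiction. -/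
theorem key_core [CompleteSpace 𝕂] (hq : 2 ≤ q) (hσ : ∀ x, σ x = x ^ q)
    {f : Fin r → PowerSeries 𝕂} (hf : ∀ j, f j ∈ TS 𝕂)
    (hL : ∀ j, Lop r θ A σ (f j) = PowerSeries.X * f j)
    (hgen : ∀ h ∈ TS 𝕂, Lop r θ A σ h = PowerSeries.X * h →
      ∃ c : Fin r → Polynomial 𝕂, (∀ j, (c j).map σ = c j) ∧
        h = ∑ j, (c j : PowerSeries 𝕂) * f j)
    (hind : ∀ a : Fin r → Polynomial 𝕂, (∀ j, (a j).map σ = a j) →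
      ∑ j, (a j : PowerSeries 𝕂) * f j = 0 → ∀ j, a j = 0)
    {z : 𝕂} {d : ℕ} (hd : (σ ^ (d + 1)) z = z)
    (hmin : ∀ i < d, (σ ^ (i + 1)) z ≠ z)
    {b : Fin r → 𝕂} (hb : ∀ j, (σ ^ (d + 1)) (b j) = b j) {k : Fin r} (hbk : b k = 1)
    (hz : ‖z‖ ≤ 1)
    (hu : ∀ n, ∑ j, b j * ev z (PowerSeries.map (σ ^ n) (f j)) = 0) : False := by
  set ζ : ℕ → 𝕂 := fun i => (σ ^ i) z with hζ
  set β : ℕ → Fin r → 𝕂 := fun i j => (σ ^ i) (b j) with hβ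
  have hζd : ∀ i, ζ (i + (d + 1)) = ζ i := fun i => by simp only [hζ]; rw [sp_add, hd]
  have hβd : ∀ i j, β (i + (d + 1)) j = β i j := fun i j => by simp only [hβ]; rw [sp_add, hb]
  have hζs : ∀ i, σ (ζ i) = ζ (i + 1) := fun i => by
    simp only [hζ]; rw [add_comm, sp_add, pow_one]
  have hβs : ∀ i j, σ (β i j) = β (i + 1) j := fun i j => by
    simp only [hβ]; rw [add_comm, sp_add, pow_one]
  have hζn : ∀ i, ‖ζ i‖ ≤ 1 := fun i => by
    simp only [hζ]; rw [frob_pow hσ, norm_pow]; exact pow_le_one₀ (norm_nonneg _) hz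
  have hCf : ∀ c j, PowerSeries.C c * f j ∈ TS 𝕂 := fun c j =>
    Subring.mul_mem _ (C_mem_TS c) (hf j)
  have hG : ∀ i ∈ Finset.range (d + 1), ∃ H ∈ TS 𝕂,
      ∑ j, PowerSeries.C (β i j) * f j = (PowerSeries.X - PowerSeries.C (ζ i)) * H := by
    intro i hi
    have hi : i ≤ d + 1 := (Finset.mem_range.1 hi).le
    have hGm : ∑ j, PowerSeries.C (β i j) * f j ∈ TS 𝕂 := Subring.sum_mem _ fun j _ => hCf _ j
    refine exists_div (hζn i) hGm ?_
    apply (σ ^ (d + 1 - i)).injective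
    have hmapm : ∀ n j, PowerSeries.map (σ ^ n) (f j) ∈ TS 𝕂 := fun n j =>
      map_mem_TS _ (frob_pow_cont hσ n) (hf j)
    rw [map_zero, ← ev_map _ (frob_pow_cont hσ _) (hζn i) hGm]
    have e1 : (σ ^ (d + 1 - i)) (ζ i) = z := by
      simp only [hζ]; rw [← sp_add, Nat.sub_add_cancel hi, hd]
    have e2 : ∀ j, (σ ^ (d + 1 - i)) (β i j) = b j := fun j => by
      simp only [hβ]; rw [← sp_add, Nat.sub_add_cancel hi, hb]
    rw [e1, map_sum, ev_sum _ hz]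
    · rw [← hu (d + 1 - i)]
      refine Finset.sum_congr rfl fun j _ => ?_
      rw [map_mul, PowerSeries.map_C, e2, ev_mul hz (C_mem_TS _) (hmapm _ _), ev_C]
    · intro j _
      exact map_mem_TS _ (frob_pow_cont hσ _) (hCf _ _)
  choose! H hH hGH using hG
  set Q : ℕ → Polynomial 𝕂 := fun i =>
    ∏ l ∈ Finset.range d, (Polynomial.X - Polynomial.C (ζ (i + 1 + l))) with hQ
  set R : ℕ → Polynomial 𝕂 := fun i =>
    ∏ l ∈ Finset.range (d + 1), (Polynomial.X - Polynomial.C (ζ (i + l))) with hR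
  have hRQ : ∀ i, R i = Q i * (Polynomial.X - Polynomial.C (ζ i)) := fun i => by
    simp only [hR, hQ]
    rw [Finset.prod_range_succ']
    simp only [add_zero]
    congr 1
    refine Finset.prod_congr rfl fun l _ => ?_
    rw [show i + (l + 1) = i + 1 + l by ring]
  have hRs : ∀ i, R (i + 1) = R i := fun i => by
    rw [hRQ i]
    simp only [hR, hQ]
    rw [Finset.prod_range_succ, show i + 1 + d = i + (d + 1) by ring, hζd]
  have hR0 : ∀ i, R i = R 0 := fun i => by
    induction i with
    | zero => rfl
    | succ i ih => rw [hRs, ih]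
  have hRmap : (R 0).map σ = R 0 := by
    refine Eq.trans ?_ (hRs 0)
    simp only [hR]
    rw [Polynomial.map_prod]
    refine Finset.prod_congr rfl fun l _ => ?_
    rw [Polynomial.map_sub, Polynomial.map_X, Polynomial.map_C, hζs,
      show 0 + l + 1 = 0 + 1 + l by ring]
  have hQmap : ∀ i, (Q i).map σ = Q (i + 1) := fun i => by
    simp only [hQ]
    rw [Polynomial.map_prod]
    refine Finset.prod_congr rfl fun l _ => ?_
    rw [Polynomial.map_sub, Polynomial.map_X, Polynomial.map_C, hζs,
      show i + 1 + l + 1 = i + 1 + 1 + l by ring]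
  have hQd : Q (d + 1) = Q 0 := by
    simp only [hQ]
    refine Finset.prod_congr rfl fun l _ => ?_
    rw [show d + 1 + 1 + l = (0 + 1 + l) + (d + 1) by ring, hζd]
  set a : Fin r → Polynomial 𝕂 := fun j =>
    ∑ i ∈ Finset.range (d + 1), Polynomial.C (β i j) * Q i with ha
  have hamap : ∀ j, (a j).map σ = a j := fun j => by
    simp only [ha]
    rw [Polynomial.map_sum]
    simp only [Polynomial.map_mul, Polynomial.map_C, hβs, hQmap]
    rw [Finset.sum_range_succ, Finset.sum_range_succ' _ d, hQd]
    have := hβd 0 j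
    rw [zero_add] at this
    rw [this]
  have hRne : R 0 ≠ 0 := by
    simp only [hR]
    exact Finset.prod_ne_zero_iff.2 fun l _ => Polynomial.X_sub_C_ne_zero _
  have hRne' : ((R 0 : Polynomial 𝕂) : PowerSeries 𝕂) ≠ 0 := by
    intro h
    exact hRne (Polynomial.coe_injective 𝕂 (by rw [h, Polynomial.coe_zero]))
  have hacoe : ∀ j, ((a j : Polynomial 𝕂) : PowerSeries 𝕂) =
      ∑ i ∈ Finset.range (d + 1), PowerSeries.C (β i j) * (Q i : PowerSeries 𝕂) := fun j => by
    simp only [ha]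
    rw [← Polynomial.coeToPowerSeries.ringHom_apply, map_sum]
    simp
  set h : PowerSeries 𝕂 := ∑ i ∈ Finset.range (d + 1), H i with hh
  have hsum : ∑ j, (a j : PowerSeries 𝕂) * f j = (R 0 : PowerSeries 𝕂) * h := by
    simp only [hacoe, Finset.sum_mul]
    rw [Finset.sum_comm, hh, Finset.mul_sum]
    refine Finset.sum_congr rfl fun i hi => ?_
    rw [← hR0 i, hRQ, Polynomial.coe_mul, Polynomial.coe_sub, Polynomial.coe_X, Polynomial.coe_C,
      mul_assoc, ← hGH i hi, Finset.mul_sum]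
    refine Finset.sum_congr rfl fun j _ => ?_
    ring
  have hhT : h ∈ TS 𝕂 := Subring.sum_mem _ hH
  have hhL : Lop r θ A σ h = PowerSeries.X * h := by
    apply mul_left_cancel₀ hRne'
    rw [← Lop_poly_mul hRmap, ← hsum, Lop_sum, mul_left_comm, ← hsum, Finset.mul_sum]
    refine Finset.sum_congr rfl fun j _ => ?_
    rw [Lop_poly_mul (hamap j), hL]
    ring
  obtain ⟨c, hc, hhc⟩ := hgen h hhT hhL
  have hzero := hind (fun j => a j - R 0 * c j)
    (fun j => by rw [Polynomial.map_sub, Polynomial.map_mul, hamap, hRmap, hc])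
    (by
      have : ∀ j, ((a j - R 0 * c j : Polynomial 𝕂) : PowerSeries 𝕂) * f j =
          (a j : PowerSeries 𝕂) * f j - (R 0 : PowerSeries 𝕂) * ((c j : PowerSeries 𝕂) * f j) := by
        intro j
        rw [Polynomial.coe_sub, Polynomial.coe_mul]
        ring
      simp only [this]
      rw [Finset.sum_sub_distrib, ← Finset.mul_sum, ← hhc, hsum, sub_self]) k
  have hak : a k = R 0 * c k := sub_eq_zero.1 hzero
  have hRz : (R 0).eval z = 0 := by
    rw [hRQ, Polynomial.eval_mul]
    simp [hζ]
  have hakz : (a k).eval z = 0 := by rw [hak, Polynomial.eval_mul, hRz, zero_mul]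
  simp only [ha] at hakz
  rw [Polynomial.eval_finsetSum, Finset.sum_range_succ'] at hakz
  have hrest : ∀ i ∈ Finset.range d,
      (Polynomial.C (β (i + 1) k) * Q (i + 1)).eval z = 0 := by
    intro i hi
    have hi := Finset.mem_range.1 hi
    rw [Polynomial.eval_mul]
    simp only [hQ]
    rw [Polynomial.eval_prod, Finset.prod_eq_zero (i := d - 1 - i), mul_zero]
    · exact Finset.mem_range.2 (by omega)
    · rw [show i + 1 + 1 + (d - 1 - i) = d + 1 by omega]
      rw [Polynomial.eval_sub, Polynomial.eval_X, Polynomial.eval_C, sub_eq_zero]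
      exact hd.symm
  rw [Finset.sum_eq_zero hrest, zero_add, Polynomial.eval_mul, Polynomial.eval_C] at hakz
  have hβ0 : β 0 k = 1 := by simp [hβ, hbk]
  rw [hβ0, one_mul] at hakz
  simp only [hQ] at hakz
  rw [Polynomial.eval_prod, Finset.prod_eq_zero_iff] at hakz
  obtain ⟨l, hl, hl0⟩ := hakz
  rw [Polynomial.eval_sub, Polynomial.eval_X, Polynomial.eval_C, sub_eq_zero] at hl0
  refine hmin l (Finset.mem_range.1 hl) ?_
  rw [show 0 + 1 + l = l + 1 by ring] at hl0
  exact hl0.symm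

/-- Non-vanishing of the determinant at periodic points. -/
theorem key_det [CompleteSpace 𝕂] (hq : 2 ≤ q) (hσ : ∀ x, σ x = x ^ q)
    (hθ : ‖θ‖ = (q : ℝ)) (hr : 0 < r) (hAr : A r ≠ 0)
    {f : Fin r → PowerSeries 𝕂} (hf : ∀ j, f j ∈ TS 𝕂)
    (hL : ∀ j, Lop r θ A σ (f j) = PowerSeries.X * f j)
    (hgen : ∀ h ∈ TS 𝕂, Lop r θ A σ h = PowerSeries.X * h →
      ∃ c : Fin r → Polynomial 𝕂, (∀ j, (c j).map σ = c j) ∧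
        h = ∑ j, (c j : PowerSeries 𝕂) * f j)
    (hind : ∀ a : Fin r → Polynomial 𝕂, (∀ j, (a j).map σ = a j) →
      ∑ j, (a j : PowerSeries 𝕂) * f j = 0 → ∀ j, a j = 0)
    {z : 𝕂} (hper : ∃ d, 0 < d ∧ (σ ^ d) z = z)
    (hdet : (Matrix.of fun i j : Fin r =>
      ev z (PowerSeries.map (σ ^ (i : ℕ)) (f j))).det = 0) : False := by
  classical
  obtain ⟨hd0, hd⟩ := Nat.find_spec hper
  have hdmin := fun m => Nat.find_min hper (m := m)
  generalize Nat.find hper = d' at hd0 hd hdmin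
  obtain ⟨d, rfl⟩ := Nat.exists_eq_succ_of_ne_zero hd0.ne'
  have hmin : ∀ i < d, (σ ^ (i + 1)) z ≠ z := fun i hi h =>
    hdmin (i + 1) (by omega) ⟨by omega, h⟩
  have hz : ‖z‖ ≤ 1 := norm_le_one_of_periodic hq hσ hd0 hd
  have hmapm : ∀ n j, PowerSeries.map (σ ^ n) (f j) ∈ TS 𝕂 := fun n j =>
    map_mem_TS _ (frob_pow_cont hσ n) (hf j)
  set E : ℕ → Fin r → 𝕂 := fun n j => ev z (PowerSeries.map (σ ^ n) (f j)) with hE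
  have hErec : ∀ n j, (σ ^ n) θ * E n j +
      ∑ i ∈ Finset.Icc 1 r, (σ ^ n) (A i) * E (n + i) j = z * E n j := by
    intro n j
    have h1 := congrArg (fun g => ev z (PowerSeries.map (σ ^ n) g)) (hL j)
    simp only [Lop, map_add, map_mul, map_sum, PowerSeries.map_C, PowerSeries.map_X,
      ← map_sp_add] at h1
    rw [ev_add hz (Subring.mul_mem _ (C_mem_TS _) (hmapm _ _)) (Subring.sum_mem _ fun i _ =>
      Subring.mul_mem _ (C_mem_TS _) (hmapm _ _)), ev_sum _ hz (fun i _ =>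
      Subring.mul_mem _ (C_mem_TS _) (hmapm _ _)), ev_mul hz (C_mem_TS _) (hmapm _ _),
      ev_mul hz X_mem_TS (hmapm _ _), ev_X, ev_C] at h1
    rw [← h1]
    congr 1
    refine Finset.sum_congr rfl fun i _ => ?_
    rw [ev_mul hz (C_mem_TS _) (hmapm _ _), ev_C]
  set u : (Fin r → 𝕂) → ℕ → 𝕂 := fun b n => ∑ j, b j * E n j with hu
  have hurec : ∀ b n, (σ ^ n) θ * u b n +
      ∑ i ∈ Finset.Icc 1 r, (σ ^ n) (A i) * u b (n + i) = z * u b n := by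
    intro b n
    simp only [hu, Finset.mul_sum]
    rw [Finset.sum_comm, ← Finset.sum_add_distrib]
    refine Finset.sum_congr rfl fun j _ => ?_
    rw [mul_left_comm z, ← hErec, mul_add, Finset.mul_sum]
    congr 1
    · ring
    · refine Finset.sum_congr rfl fun i _ => ?_
      ring
  have hfwd : ∀ b, (∀ n < r, u b n = 0) → ∀ n, u b n = 0 := by
    intro b hb n
    induction n using Nat.strong_induction_on with
    | _ n ih =>
      by_cases hn : n < r
      · exact hb n hn
      · obtain ⟨m, rfl⟩ := Nat.exists_eq_add_of_le' (not_lt.1 hn)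
        have h1 := hurec b m
        rw [ih m (by omega), mul_zero, mul_zero, zero_add,
          Finset.sum_eq_single_of_mem r (Finset.mem_Icc.2 ⟨hr, le_rfl⟩)] at h1
        · refine (mul_eq_zero.1 h1).resolve_left fun h => hAr ?_
          exact (map_eq_zero _).1 h
        · intro i hi hir
          have := (Finset.mem_Icc.1 hi).2
          rw [ih (m + i) (by omega), mul_zero]
  have hbwd : ∀ b N, (∀ n ≥ N, u b n = 0) → ∀ n, u b n = 0 := by
    intro b N
    induction N with
    | zero => intro h n; exact h n (Nat.zero_le _)
    | succ N ih =>
      intro h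
      refine ih fun n hn => ?_
      rcases hn.eq_or_lt with rfl | hn
      · have h1 := hurec b N
        rw [Finset.sum_eq_zero, add_zero] at h1
        · rw [← sub_eq_zero, ← sub_mul] at h1
          refine (mul_eq_zero.1 h1).resolve_left fun h => ?_
          rw [sub_eq_zero, frob_pow hσ] at h
          rw [← h, norm_pow, hθ] at hz
          have : (1 : ℝ) < (q : ℝ) ^ q ^ N := one_lt_pow₀ (by exact_mod_cast (by omega : 1 < q))
            (pow_ne_zero _ (by omega))
          linarith
        · intro i hi
          have := (Finset.mem_Icc.1 hi).1
          rw [h (N + i) (by omega), mul_zero]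
      · exact h n hn
  have hfrob : ∀ b, (∀ n, u b n = 0) → ∀ n, u (fun j => (σ ^ (d + 1)) (b j)) n = 0 := by
    intro b hb
    refine hbwd _ (d + 1) fun n hn => ?_
    obtain ⟨m, rfl⟩ := Nat.exists_eq_add_of_le hn
    have h1 := congrArg (σ ^ (d + 1)) (hb m)
    simp only [hu, map_sum, map_mul, map_zero] at h1
    simp only [hu]
    rw [← h1]
    refine Finset.sum_congr rfl fun j _ => ?_
    congr 1
    simp only [hE]
    rw [map_sp_add, ← ev_map _ (frob_pow_cont hσ _) hz (hmapm _ _)]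
    congr 1
    exact hd.symm
  have hred : ∀ N, ∀ b : Fin r → 𝕂, (Finset.univ.filter fun j => b j ≠ 0).card ≤ N → b ≠ 0 →
      (∀ n, u b n = 0) → ∃ b' : Fin r → 𝕂, (∀ n, u b' n = 0) ∧ (∃ k, b' k = 1) ∧
        ∀ j, (σ ^ (d + 1)) (b' j) = b' j := by
    intro N
    induction N with
    | zero =>
      intro b hb hb0
      exfalso
      apply hb0
      rw [Nat.le_zero, Finset.card_eq_zero, Finset.filter_eq_empty_iff] at hb
      funext j
      simpa using hb (Finset.mem_univ j)
    | succ N ih =>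
      intro b hb hb0 hub
      obtain ⟨k, hk⟩ := Function.ne_iff.1 hb0
      have hk : b k ≠ 0 := hk
      set c : Fin r → 𝕂 := fun j => (b k)⁻¹ * b j with hc
      have huc : ∀ n, u c n = 0 := fun n => by
        have : u c n = (b k)⁻¹ * u b n := by
          simp only [hu, hc, Finset.mul_sum, mul_assoc]
        rw [this, hub, mul_zero]
      have hck : c k = 1 := inv_mul_cancel₀ hk
      by_cases hfix : ∀ j, (σ ^ (d + 1)) (c j) = c j
      · exact ⟨c, huc, ⟨k, hck⟩, hfix⟩
      · refine ih (fun j => (σ ^ (d + 1)) (c j) - c j) ?_ ?_ ?_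
        · refine Nat.le_of_lt_succ (lt_of_lt_of_le (Finset.card_lt_card ?_) hb)
          rw [Finset.ssubset_iff_of_subset]
          · exact ⟨k, by simp [hk], fun hmem => (Finset.mem_filter.1 hmem).2 (by
              change (σ ^ (d + 1)) (c k) - c k = 0
              rw [hck, map_one, sub_self])⟩
          · intro j hj
            simp only [Finset.mem_filter, Finset.mem_univ, true_and] at hj ⊢
            intro hbj
            apply hj
            simp [hc, hbj]
        · intro h
          exact hfix fun j => sub_eq_zero.1 (congrFun h j)
        · intro n
          have : u (fun j => (σ ^ (d + 1)) (c j) - c j) n =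
              u (fun j => (σ ^ (d + 1)) (c j)) n - u c n := by
            simp only [hu, sub_mul, Finset.sum_sub_distrib]
          rw [this, hfrob c huc, huc, sub_zero]
  obtain ⟨b, hb0, hb⟩ := Matrix.exists_mulVec_eq_zero_iff.2 hdet
  have hub : ∀ n, u b n = 0 := hfwd b fun n hn => by
    have := congrFun hb ⟨n, hn⟩
    simp only [Matrix.mulVec, dotProduct, Matrix.of_apply, Pi.zero_apply] at this
    rw [← this]
    refine Finset.sum_congr rfl fun j _ => ?_
    rw [mul_comm]
  obtain ⟨b', hub', ⟨k, hk⟩, hfix⟩ := hred _ b le_rfl hb0 hub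
  exact key_core hq hσ hf hL hgen hind hd hmin hfix hk hz hub'

end RAT


section RAT

set_option linter.unusedSectionVars false

variable {𝕂 : Type} [NontriviallyNormedField 𝕂]

theorem sum_Icc_one {M : Type*} [AddCommMonoid M] (g : ℕ → M) (n : ℕ) :
    ∑ i ∈ Finset.Icc 1 n, g i = ∑ i ∈ Finset.range n, g (i + 1) := by
  induction n with
  | zero => simp
  | succ n ih => rw [Finset.sum_Icc_succ_top (by omega), ih, Finset.sum_range_succ]

theorem det_theta {n : ℕ} (θ : 𝕂) (A : ℕ → 𝕂) :
    (ThetaPS 𝕂 (n + 1) θ A).det =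
      (-1) ^ n * ((PowerSeries.X - PowerSeries.C θ) * PowerSeries.C (A (n + 1))⁻¹) := by
  rw [Matrix.det_succ_column_zero, Finset.sum_eq_single_of_mem (Fin.last n) (Finset.mem_univ _)]
  · have h1 : (ThetaPS 𝕂 (n + 1) θ A).submatrix (Fin.last n).succAbove Fin.succ = 1 := by
      ext1 a b
      have ha : (a : ℕ) + 1 < n + 1 := by omega
      simp only [Matrix.submatrix_apply, ThetaPS, Matrix.of_apply, Fin.succAbove_last,
        Fin.val_castSucc, Fin.val_succ, if_pos ha, Matrix.one_apply]
      by_cases hab : a = b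
      · simp [hab]
      · have : ¬ ((b : ℕ) + 1 = a + 1) := fun h => hab (Fin.ext (by omega))
        rw [if_neg hab, if_neg this]
    rw [h1, Matrix.det_one, mul_one]
    simp [ThetaPS]
  · intro i _ hi
    have hi' : (i : ℕ) + 1 < n + 1 := by
      have := Fin.val_lt_last hi
      omega
    have : ThetaPS 𝕂 (n + 1) θ A i 0 = 0 := by
      simp only [ThetaPS, Matrix.of_apply, if_pos hi']
      simp
    rw [this, mul_zero, zero_mul]

theorem ups_rel {r : ℕ} {θ : 𝕂} {A : ℕ → 𝕂} {σ : 𝕂 →+* 𝕂} (hAr : A r ≠ 0)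
    {f : Fin r → PowerSeries 𝕂} (hL : ∀ j, Lop r θ A σ (f j) = PowerSeries.X * f j) :
    (Matrix.of fun i j : Fin r => PowerSeries.map (σ ^ (i : ℕ)) (f j)).map (PowerSeries.map σ) =
      ThetaPS 𝕂 r θ A * Matrix.of fun i j : Fin r => PowerSeries.map (σ ^ (i : ℕ)) (f j) := by
  ext1 i j
  have hlhs : PowerSeries.map σ (PowerSeries.map (σ ^ (i : ℕ)) (f j)) =
      PowerSeries.map (σ ^ ((i : ℕ) + 1)) (f j) := by
    rw [add_comm, map_sp_add, pow_one]
  simp only [Matrix.map_apply, Matrix.of_apply, Matrix.mul_apply, ThetaPS]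
  rw [hlhs]
  by_cases hi : (i : ℕ) + 1 < r
  · simp only [if_pos hi]
    rw [Finset.sum_eq_single_of_mem ⟨(i : ℕ) + 1, hi⟩ (Finset.mem_univ _)]
    · simp
    · intro k _ hk
      have : ¬ ((k : ℕ) = i + 1) := fun h => hk (Fin.ext h)
      rw [if_neg this, zero_mul]
  · simp only [if_neg hi]
    obtain ⟨n, rfl⟩ : ∃ n, r = n + 1 := ⟨r - 1, by have := i.2; omega⟩
    have hin : (i : ℕ) = n := by have := i.2; omega
    rw [hin, Fin.sum_univ_succ]
    simp only [Fin.val_zero, if_true, Fin.val_succ, Nat.succ_ne_zero, if_false]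
    have h1 := hL j
    unfold Lop at h1
    rw [sum_Icc_one, Finset.sum_range_succ, Finset.sum_range] at h1
    have h2 : PowerSeries.C (A (n + 1)) * PowerSeries.C (A (n + 1))⁻¹ = 1 := by
      rw [← map_mul, mul_inv_cancel₀ hAr, map_one]
    have h3 : ∑ k : Fin n, -(PowerSeries.C (A ((k : ℕ) + 1)) * PowerSeries.C (A (n + 1))⁻¹) *
        PowerSeries.map (σ ^ ((k : ℕ) + 1)) (f j) =
        - PowerSeries.C (A (n + 1))⁻¹ * ∑ k : Fin n, PowerSeries.C (A ((k : ℕ) + 1)) *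
          PowerSeries.map (σ ^ ((k : ℕ) + 1)) (f j) := by
      rw [Finset.mul_sum]
      refine Finset.sum_congr rfl fun k _ => ?_
      ring
    have h4 : PowerSeries.map (σ ^ 0) (f j) = f j := by
      ext k; simp
    rw [h3, h4]
    linear_combination (- PowerSeries.map (σ ^ (n + 1)) (f j)) * h2 +
      PowerSeries.C (A (n + 1))⁻¹ * h1

variable {q : ℕ} {σ : 𝕂 →+* 𝕂} {θ : 𝕂} {r : ℕ} {A : ℕ → 𝕂}
variable [IsUltrametricDist 𝕂]

theorem ups_unit [CompleteSpace 𝕂] [IsAlgClosed 𝕂] (hq : 2 ≤ q) (hσ : ∀ x, σ x = x ^ q)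
    (hθ : ‖θ‖ = (q : ℝ)) (hr : 0 < r) (hAr : A r ≠ 0)
    {f : Fin r → PowerSeries 𝕂} (hf : ∀ j, f j ∈ TS 𝕂)
    (hL : ∀ j, Lop r θ A σ (f j) = PowerSeries.X * f j)
    (hgen : ∀ h ∈ TS 𝕂, Lop r θ A σ h = PowerSeries.X * h →
      ∃ c : Fin r → Polynomial 𝕂, (∀ j, (c j).map σ = c j) ∧
        h = ∑ j, (c j : PowerSeries 𝕂) * f j)
    (hind : ∀ a : Fin r → Polynomial 𝕂, (∀ j, (a j).map σ = a j) →
      ∑ j, (a j : PowerSeries 𝕂) * f j = 0 → ∀ j, a j = 0) :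
    MemGLT 𝕂 (Matrix.of fun i j : Fin r => PowerSeries.map (σ ^ (i : ℕ)) (f j)) := by
  have hmapm : ∀ n j, PowerSeries.map (σ ^ n) (f j) ∈ TS 𝕂 := fun n j =>
    map_mem_TS _ (frob_pow_cont hσ n) (hf j)
  set U : Matrix (Fin r) (Fin r) (PowerSeries 𝕂) :=
    Matrix.of fun i j : Fin r => PowerSeries.map (σ ^ (i : ℕ)) (f j) with hU
  set V : Matrix (Fin r) (Fin r) (TS 𝕂) :=
    Matrix.of fun i j : Fin r => ⟨PowerSeries.map (σ ^ (i : ℕ)) (f j), hmapm i j⟩ with hV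
  have hVU : V.map (TS 𝕂).subtype = U := by
    ext1 i j
    simp [hV, hU]
  have hdetVU : ((V.det : TS 𝕂) : PowerSeries 𝕂) = U.det := by
    have := (TS 𝕂).subtype.map_det V
    rw [RingHom.mapMatrix_apply, hVU] at this
    exact this
  have hUm : U.det ∈ TS 𝕂 := by rw [← hdetVU]; exact V.det.2
  -- the determinant does not vanish at periodic points
  have hnv : ∀ z d, 0 < d → (σ ^ d) z = z → ev z U.det ≠ 0 := by
    intro z d hd0 hd h0
    have hz : ‖z‖ ≤ 1 := norm_le_one_of_periodic hq hσ hd0 hd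
    refine key_det hq hσ hθ hr hAr hf hL hgen hind ⟨d, hd0, hd⟩ ?_
    rw [← h0, ← hdetVU]
    have := (evHom z hz).map_det V
    rw [RingHom.mapMatrix_apply] at this
    refine Eq.trans ?_ this.symm
    rfl
  -- the functional equation
  obtain ⟨n, rfl⟩ : ∃ n, r = n + 1 := ⟨r - 1, by omega⟩
  have hFE : PowerSeries.map σ U.det =
      (-1) ^ n * ((PowerSeries.X - PowerSeries.C θ) * PowerSeries.C (A (n + 1))⁻¹) * U.det := by
    have h1 := congrArg Matrix.det (ups_rel hAr hL)
    rw [Matrix.det_mul, det_theta] at h1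
    rw [← h1, RingHom.map_det, RingHom.mapMatrix_apply]
  have hθ0 := theta_ne hq hθ
  have hκ : (-((-1) ^ n * (A (n + 1))⁻¹ * θ)) ≠ 0 :=
    neg_ne_zero.2 (mul_ne_zero (mul_ne_zero (pow_ne_zero _ (by simp)) (inv_ne_zero hAr)) hθ0)
  obtain ⟨l, hl⟩ := IsAlgClosed.exists_pow_nat_eq (-((-1) ^ n * (A (n + 1))⁻¹ * θ))
    (n := q - 1) (by omega)
  have hl0 : l ≠ 0 := by
    rintro rfl
    rw [zero_pow (by omega)] at hl
    exact hκ hl.symm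
  have hσl : σ l = l * (-((-1) ^ n * (A (n + 1))⁻¹ * θ)) := by
    rw [hσ, ← hl, ← pow_succ', Nat.sub_add_cancel (by omega)]
  have hCl : PowerSeries.C l * PowerSeries.C l⁻¹ = 1 := by
    rw [← map_mul, mul_inv_cancel₀ hl0, map_one]
  have hw : PowerSeries.C l⁻¹ * U.det ∈ TS 𝕂 := Subring.mul_mem _ (C_mem_TS _) hUm
  have hwFE : PowerSeries.map σ (PowerSeries.C l⁻¹ * U.det) =
      (1 - PowerSeries.C θ⁻¹ * PowerSeries.X) * (PowerSeries.C l⁻¹ * U.det) := by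
    rw [map_mul, PowerSeries.map_C, hFE, map_inv₀, hσl]
    have h1 : PowerSeries.C ((l * (-((-1) ^ n * (A (n + 1))⁻¹ * θ)))⁻¹) *
        ((-1) ^ n * PowerSeries.C (A (n + 1))⁻¹) = - (PowerSeries.C θ⁻¹ * PowerSeries.C l⁻¹) := by
      have : ((-1) ^ n : PowerSeries 𝕂) = PowerSeries.C ((-1) ^ n) := by simp
      rw [this, ← map_mul, ← map_mul, ← map_mul, ← map_neg]
      congr 1
      have hm : ((-1 : 𝕂)) ^ n ≠ 0 := pow_ne_zero _ (by simp)
      field_simp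
    have h2 : PowerSeries.C θ⁻¹ * PowerSeries.C θ = 1 := by
      rw [← map_mul, inv_mul_cancel₀ hθ0, map_one]
    linear_combination ((PowerSeries.X - PowerSeries.C θ) * U.det) * h1 +
      (PowerSeries.C l⁻¹ * U.det) * h2
  have hunit : IsUnit V.det := by
    rcases dichotomy hq hθ hσ hw hwFE with ⟨v, hv, hwv⟩ | ⟨z, d, hd0, hd, h0⟩
    · refine IsUnit.of_mul_eq_one ⟨PowerSeries.C l⁻¹ * v, Subring.mul_mem _ (C_mem_TS _) hv⟩ ?_
      apply Subtype.ext
      change ((V.det : TS 𝕂) : PowerSeries 𝕂) * (PowerSeries.C l⁻¹ * v) = 1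
      rw [hdetVU, ← hwv]
      ring
    · exfalso
      have hz : ‖z‖ ≤ 1 := norm_le_one_of_periodic hq hσ hd0 hd
      rw [ev_mul hz (C_mem_TS _) hUm, ev_C] at h0
      exact hnv z d hd0 hd ((mul_eq_zero.1 h0).resolve_left (inv_ne_zero hl0))
  refine ⟨fun i j => mem_TS.1 (hmapm i j), (V⁻¹).map (TS 𝕂).subtype,
    fun i j => mem_TS.1 (V⁻¹ i j).2, ?_, ?_⟩
  · rw [← hVU, ← Matrix.map_mul, Matrix.mul_nonsing_inv _ hunit]
    simp
  · rw [← hVU, ← Matrix.map_mul, Matrix.nonsing_inv_mul _ hunit]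
    simp

end RAT

theorem stmt7
    (𝕂 : Type) [NontriviallyNormedField 𝕂] [CompleteSpace 𝕂] [IsAlgClosed 𝕂]
    (hna : ∀ x y : 𝕂, ‖x + y‖ ≤ max ‖x‖ ‖y‖)
    (p e q : ℕ) (hp : p.Prime) (hcharp : CharP 𝕂 p) (he : 0 < e) (hqpe : q = p ^ e)
    (θ : 𝕂) (hθ : ‖θ‖ = (q : ℝ))
    (r : ℕ) (hr : 0 < r) (A : ℕ → 𝕂) (hAr : A r ≠ 0)
    (α : ℕ → 𝕂) (hα0 : α 0 = 1)
    (hαsum : ∀ z : 𝕂, Summable fun n => α n * z ^ q ^ n)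
    (hαFE : ∀ z : 𝕂, expF 𝕂 q α (θ * z) = phiT 𝕂 q r θ A (expF 𝕂 q α z))
    (π : Fin r → 𝕂) (hπ : IsPeriodBasis 𝕂 q r α θ π) :
    MemGLT 𝕂 (Matrix.of fun i j : Fin r => twist 𝕂 q (i : ℕ) (AGF 𝕂 q α θ (π j))) ∧
      twistM 𝕂 q 1 (Matrix.of fun i j : Fin r => twist 𝕂 q (i : ℕ) (AGF 𝕂 q α θ (π j))) =
        ThetaPS 𝕂 r θ A *
          (Matrix.of fun i j : Fin r => twist 𝕂 q (i : ℕ) (AGF 𝕂 q α θ (π j))) := by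
  have hpp : Fact p.Prime := ⟨hp⟩
  have hq : 2 ≤ q := by
    rw [hqpe]
    calc 2 ≤ p := hp.two_le
      _ = p ^ 1 := (pow_one p).symm
      _ ≤ p ^ e := Nat.pow_le_pow_right hp.pos he
  have hult : IsUltrametricDist 𝕂 :=
    IsUltrametricDist.isUltrametricDist_of_forall_norm_add_le_max_norm hna
  have hexp : ExpChar 𝕂 p := ExpChar.prime hp
  obtain ⟨σ, hσ⟩ : ∃ σ : 𝕂 →+* 𝕂, ∀ x, σ x = x ^ q :=
    ⟨iterateFrobenius 𝕂 p e, fun x => by rw [iterateFrobenius_def, hqpe]⟩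
  have htw : ∀ n (f : PowerSeries 𝕂), twist 𝕂 q n f = PowerSeries.map (σ ^ n) f := by
    intro n f
    ext k
    rw [PowerSeries.coeff_map, frob_pow hσ, twist, PowerSeries.coeff_mk]
  have hL : ∀ j, Lop r θ A σ (AGF 𝕂 q α θ (π j)) = PowerSeries.X * AGF 𝕂 q α θ (π j) :=
    fun j => agf_FE hq hσ hθ hαFE (hπ.1 j)
  simp only [htw]
  refine ⟨ups_unit hq hσ hθ hr hAr (fun j => agf_mem hq hα0 hσ hαsum hθ (π j)) hL
    (fun h hh hhL => gen_of_basis hq hα0 hσ hθ hαsum hαFE hπ hh hhL)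
    (fun a ha h0 => ind_of_basis hq hα0 hσ hθ hαsum hαFE hπ a ha h0), ?_⟩
  rw [← ups_rel hAr hL]
  ext1 i j
  simp only [twistM, Matrix.of_apply, Matrix.map_apply]
  rw [htw, pow_one]

end DrinfeldRAT
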